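/- If (QIA_p) holds for some prime p, then for every non-negative function ψ : ℕ → ℝ which is supported on the set of squarefree integers (i.e. ψ(n) = 0 whenever n is not squarefree) and which satisfies Σ_{n∈ℕ} λ(A_n(ψ)) = ∞, one has λ(W_∞(ψ)) = 1. -/

import Mathlib

open MeasureTheory Filter

noncomputable section

/-- The set `E_n(ψ) ⊆ ℤ_p`: union over integers `a` with `|a| ≤ n`, `gcd(a,n) = 1`
of the closed balls `{x : |x - a/n|_p ≤ ψ(n)}`. -/
def padicE (p : ℕ) [Fact p.Prime] (ψ : ℕ → ℝ) (n : ℕ) : Set ℤ_[p] :=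
  {x | ∃ a : ℤ, |a| ≤ (n : ℤ) ∧ Int.gcd a n = 1 ∧
    ‖(x : ℚ_[p]) - (a : ℚ_[p]) / (n : ℚ_[p])‖ ≤ ψ n}

/-- The set `A_n(ψ) ⊆ ℝ/ℤ`: union over `1 ≤ a ≤ n`, `gcd(a,n) = 1` of the closed
intervals `[a/n - ψ(n), a/n + ψ(n)]` taken mod 1. -/
def circleA (ψ : ℕ → ℝ) (n : ℕ) : Set UnitAddCircle :=
  {x | ∃ a : ℕ, 1 ≤ a ∧ a ≤ n ∧ Nat.gcd a n = 1 ∧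
    ‖x - (((a : ℝ) / (n : ℝ) : ℝ) : UnitAddCircle)‖ ≤ ψ n}

/-- `W_∞(ψ)`: the points of `ℝ/ℤ` lying in infinitely many of the sets `A_n(ψ)`. -/
def circleW (ψ : ℕ → ℝ) : Set UnitAddCircle :=
  {x | {n : ℕ | x ∈ circleA ψ n}.Infinite}

/-- `(QIA_p)` holds for the Haar probability measure `μ` on `ℤ_p`: quasi-independence
on average holds for every non-negative `ψ` with divergent sum of measures. -/
def QIApHolds (p : ℕ) [Fact p.Prime] [MeasurableSpace ℤ_[p]] (μ : Measure ℤ_[p]) : Prop :=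
  ∀ ψ : ℕ → ℝ, (∀ n, 0 ≤ ψ n) → (∑' n : ℕ, μ (padicE p ψ n)) = ⊤ →
    0 < atTop.limsup (fun N : ℕ =>
      (∑ n ∈ Finset.Icc 1 N, μ (padicE p ψ n)) ^ 2 /
        ∑ m ∈ Finset.Icc 1 N, ∑ n ∈ Finset.Icc 1 N, μ (padicE p ψ m ∩ padicE p ψ n))

theorem half_le_prod_one_sub_inv_sq (s : Finset ℕ) (hs : ∀ k ∈ s, 2 ≤ k) :
    (1 / 2 : ℝ) ≤ ∏ k ∈ s, (1 - 1 / (k : ℝ) ^ 2) := by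
  have tele : ∀ M : ℕ, ∏ k ∈ Finset.Ico 2 (M + 2), (1 - 1 / (k : ℝ) ^ 2) =
      ((M : ℝ) + 2) / (2 * (M + 1)) := by
    intro M
    induction M with
    | zero => simp
    | succ M ih =>
      rw [show M + 1 + 2 = (M + 2) + 1 by ring, Finset.prod_Ico_succ_top (by omega), ih]
      push_cast
      have h1 : (M : ℝ) + 1 ≠ 0 := by positivity
      have h2 : (M : ℝ) + 2 ≠ 0 := by positivity
      have h3 : (M : ℝ) + 1 + 1 ≠ 0 := by positivity
      field_simp
      ring
  have hfac : ∀ k : ℕ, 2 ≤ k → 0 ≤ 1 - 1 / (k : ℝ) ^ 2 ∧ 1 - 1 / (k : ℝ) ^ 2 ≤ 1 := by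
    intro k hk
    have hk' : (2 : ℝ) ≤ k := by exact_mod_cast hk
    have : 1 / (k : ℝ) ^ 2 ≤ 1 := by
      rw [div_le_one (by positivity)]
      nlinarith
    exact ⟨by linarith, by linarith [show 0 ≤ 1 / (k : ℝ) ^ 2 by positivity]⟩
  obtain ⟨M, hM⟩ : ∃ M, s ⊆ Finset.Ico 2 (M + 2) :=
    ⟨s.sup id, fun k hk => Finset.mem_Ico.2 ⟨hs k hk, by
      have : k ≤ s.sup id := Finset.le_sup (f := id) hk
      omega⟩⟩
  calc (1 / 2 : ℝ) ≤ (M + 2) / (2 * (M + 1)) := by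
        rw [div_le_div_iff₀ (by positivity) (by positivity)]
        nlinarith
    _ = ∏ k ∈ Finset.Ico 2 (M + 2), (1 - 1 / (k : ℝ) ^ 2) := (tele M).symm
    _ = (∏ k ∈ Finset.Ico 2 (M + 2) \ s, (1 - 1 / (k : ℝ) ^ 2)) *
          ∏ k ∈ s, (1 - 1 / (k : ℝ) ^ 2) := (Finset.prod_sdiff hM).symm
    _ ≤ 1 * ∏ k ∈ s, (1 - 1 / (k : ℝ) ^ 2) := by
        refine mul_le_mul_of_nonneg_right (Finset.prod_le_one ?_ ?_)
          (Finset.prod_nonneg fun k hk => (hfac k (hs k hk)).1)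
        · intro k hk
          exact (hfac k (Finset.mem_Ico.1 (Finset.mem_sdiff.1 hk).1).1).1
        · intro k hk
          exact (hfac k (Finset.mem_Ico.1 (Finset.mem_sdiff.1 hk).1).1).2
    _ = _ := one_mul _

theorem prod_primeFactors_one_add_inv_le (n : ℕ) (hn : n ≠ 0) :
    ∏ q ∈ n.primeFactors, (1 + 1 / (q : ℝ)) ≤ ∑ d ∈ n.divisors, 1 / (d : ℝ) := by
  classical
  rw [Finset.prod_one_add]
  have hprime : ∀ t ∈ n.primeFactors.powerset, ∀ q ∈ t, q.Prime := fun t ht q hq =>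
    Nat.prime_of_mem_primeFactors (Finset.mem_powerset.1 ht hq)
  have hinj : Set.InjOn (fun t : Finset ℕ => ∏ q ∈ t, q) n.primeFactors.powerset := by
    intro t ht u hu h
    have h' := congrArg Nat.primeFactors h
    simpa [Nat.primeFactors_prod (hprime t ht), Nat.primeFactors_prod (hprime u hu)] using h'
  calc ∑ t ∈ n.primeFactors.powerset, ∏ q ∈ t, 1 / (q : ℝ)
      = ∑ t ∈ n.primeFactors.powerset, 1 / ((∏ q ∈ t, q : ℕ) : ℝ) := by
        refine Finset.sum_congr rfl fun t _ => ?_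
        simp
    _ = ∑ d ∈ n.primeFactors.powerset.image (fun t => ∏ q ∈ t, q), 1 / (d : ℝ) :=
        (Finset.sum_image (f := fun d : ℕ => 1 / (d : ℝ)) hinj).symm
    _ ≤ _ := by
        refine Finset.sum_le_sum_of_subset_of_nonneg ?_ fun _ _ _ => by positivity
        intro d hd
        obtain ⟨t, ht, rfl⟩ := Finset.mem_image.1 hd
        refine Nat.mem_divisors.2 ⟨?_, hn⟩
        exact (Finset.prod_dvd_prod_of_subset _ _ _ (Finset.mem_powerset.1 ht)).trans
          (Nat.prod_primeFactors_dvd n)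

theorem totient_div_eq_prod (n : ℕ) (hn : n ≠ 0) :
    (n.totient : ℝ) / n = ∏ q ∈ n.primeFactors, (1 - 1 / (q : ℝ)) := by
  have h := Nat.totient_eq_mul_prod_factors n
  have h' : (n.totient : ℝ) = n * ∏ q ∈ n.primeFactors, (1 - (q : ℝ)⁻¹) := by
    simpa using congrArg (Rat.cast : ℚ → ℝ) h
  have : (n : ℝ) ≠ 0 := by exact_mod_cast hn
  rw [h', mul_div_cancel_left₀ _ this]
  simp

theorem div_totient_le (n : ℕ) (hn : n ≠ 0) :
    (n : ℝ) / n.totient ≤ 2 * ∑ d ∈ n.divisors, 1 / (d : ℝ) := by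
  have h1 := half_le_prod_one_sub_inv_sq n.primeFactors fun q hq =>
    (Nat.prime_of_mem_primeFactors hq).two_le
  have h2 := prod_primeFactors_one_add_inv_le n hn
  have hφ : (0 : ℝ) < n.totient := by exact_mod_cast Nat.totient_pos.2 (Nat.pos_of_ne_zero hn)
  have hn' : (0 : ℝ) < n := by exact_mod_cast Nat.pos_of_ne_zero hn
  have h3 : ∏ q ∈ n.primeFactors, (1 - 1 / (q : ℝ) ^ 2) =
      (n.totient : ℝ) / n * ∏ q ∈ n.primeFactors, (1 + 1 / (q : ℝ)) := by
    rw [totient_div_eq_prod n hn, ← Finset.prod_mul_distrib]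
    refine Finset.prod_congr rfl fun q _ => ?_
    rw [← one_div_pow]
    ring
  rw [h3] at h1
  have h4 : (1 / 2 : ℝ) ≤ (n.totient : ℝ) / n * ∑ d ∈ n.divisors, 1 / (d : ℝ) :=
    h1.trans (mul_le_mul_of_nonneg_left h2 (by positivity))
  rw [div_le_iff₀ hφ]
  have h5 := mul_le_mul_of_nonneg_left h4 (by positivity : (0 : ℝ) ≤ 2 * n)
  have h6 : 2 * (n : ℝ) * ((n.totient : ℝ) / n * ∑ d ∈ n.divisors, 1 / (d : ℝ)) =
      2 * (∑ d ∈ n.divisors, 1 / (d : ℝ)) * n.totient := by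
    field_simp
  linarith

theorem sum_Icc_sum_divisorsAntidiagonal (x : ℕ) (g : ℕ → ℕ → ℝ) :
    ∑ c ∈ Finset.Icc 1 x, ∑ q ∈ c.divisorsAntidiagonal, g q.1 q.2 =
      ∑ b ∈ Finset.Icc 1 x, ∑ a ∈ Finset.Icc 1 (x / b), g a b := by
  rw [Finset.sum_sigma', Finset.sum_sigma']
  refine Finset.sum_bij' (fun s _ => ⟨s.2.2, s.2.1⟩) (fun s _ => ⟨s.2 * s.1, (s.2, s.1)⟩)
    ?_ ?_ ?_ ?_ ?_
  · rintro ⟨c, a, b⟩ h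
    simp only [Finset.mem_sigma, Finset.mem_Icc, Nat.mem_divisorsAntidiagonal] at h ⊢
    obtain ⟨⟨h1, h2⟩, rfl, h3⟩ := h
    have ha : 0 < a := Nat.pos_of_ne_zero fun h => h3 (by simp [h])
    have hb : 0 < b := Nat.pos_of_ne_zero fun h => h3 (by simp [h])
    exact ⟨⟨hb, (Nat.le_mul_of_pos_left b ha).trans h2⟩, ha, (Nat.le_div_iff_mul_le hb).2 h2⟩
  · rintro ⟨b, a⟩ h
    simp only [Finset.mem_sigma, Finset.mem_Icc, Nat.mem_divisorsAntidiagonal] at h ⊢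
    obtain ⟨⟨h1, h2⟩, h3, h4⟩ := h
    have hp : 0 < a * b := Nat.mul_pos h3 h1
    exact ⟨⟨hp, (Nat.le_div_iff_mul_le h1).1 h4⟩, trivial, hp.ne'⟩
  · rintro ⟨c, a, b⟩ h
    simp only [Finset.mem_sigma, Nat.mem_divisorsAntidiagonal] at h
    obtain ⟨_, rfl, _⟩ := h
    rfl
  · rintro ⟨b, a⟩ _
    rfl
  · rintro ⟨c, a, b⟩ _
    rfl

theorem sum_mul_one_add_log_le (f : ℕ → ℝ) (hf : ∀ n, 0 ≤ f n) (K : ℝ) (hK : 0 ≤ K)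
    (hsub : ∀ a b : ℕ, IsPrimePow a → b ≠ 0 → f (a * b) ≤ K * f b) (x : ℕ) :
    (∑ c ∈ Finset.Icc 1 x, f c) * (1 + Real.log x) ≤
      (1 + K * (Real.log 4 + 4)) * x * ∑ c ∈ Finset.Icc 1 x, f c / c := by
  have h1 : ∀ c ∈ Finset.Icc 1 x, f c * (1 + Real.log x) ≤ x * (f c / c) + f c * Real.log c := by
    intro c hc
    have hc' := Finset.mem_Icc.1 hc
    have hc0 : (0 : ℝ) < c := by exact_mod_cast hc'.1
    have hx0 : (0 : ℝ) < x := by exact_mod_cast hc'.1.trans hc'.2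
    have := Real.log_le_sub_one_of_pos (div_pos hx0 hc0)
    rw [Real.log_div hx0.ne' hc0.ne'] at this
    calc f c * (1 + Real.log x) ≤ f c * (x / c + Real.log c) :=
          mul_le_mul_of_nonneg_left (by linarith) (hf c)
      _ = _ := by ring
  have h2 : ∑ c ∈ Finset.Icc 1 x, f c * Real.log c ≤
      K * (Real.log 4 + 4) * x * ∑ c ∈ Finset.Icc 1 x, f c / c := by
    calc ∑ c ∈ Finset.Icc 1 x, f c * Real.log c
        ≤ ∑ c ∈ Finset.Icc 1 x, ∑ q ∈ c.divisorsAntidiagonal,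
            ArithmeticFunction.vonMangoldt q.1 * (K * f q.2) := by
          refine Finset.sum_le_sum fun c hc => ?_
          rw [← ArithmeticFunction.vonMangoldt_sum, Finset.mul_sum, ←
            Nat.sum_divisorsAntidiagonal fun a _ => f c * ArithmeticFunction.vonMangoldt a]
          refine Finset.sum_le_sum fun q hq => ?_
          obtain ⟨hq1, hq2⟩ := Nat.mem_divisorsAntidiagonal.1 hq
          by_cases hpp : IsPrimePow q.1
          · rw [mul_comm]
            refine mul_le_mul_of_nonneg_left ?_ ArithmeticFunction.vonMangoldt_nonneg
            rw [← hq1]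
            exact hsub _ _ hpp fun h => hq2 (by rw [← hq1, h, mul_zero])
          · simp [ArithmeticFunction.vonMangoldt_eq_zero_iff.2 hpp]
      _ = ∑ b ∈ Finset.Icc 1 x, ∑ a ∈ Finset.Icc 1 (x / b),
            ArithmeticFunction.vonMangoldt a * (K * f b) :=
          sum_Icc_sum_divisorsAntidiagonal x
            fun a b => ArithmeticFunction.vonMangoldt a * (K * f b)
      _ ≤ ∑ b ∈ Finset.Icc 1 x, K * (Real.log 4 + 4) * x * (f b / b) := by
          refine Finset.sum_le_sum fun b hb => ?_
          have hb' := Finset.mem_Icc.1 hb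
          have hb0 : (0 : ℝ) < b := by exact_mod_cast hb'.1
          rw [← Finset.sum_mul]
          have hpsi : ∑ a ∈ Finset.Icc 1 (x / b), ArithmeticFunction.vonMangoldt a ≤
              (Real.log 4 + 4) * (x / b) := by
            have := Chebyshev.psi_le_const_mul_self (x := (x : ℝ) / b) (by positivity)
            rw [Chebyshev.psi, Nat.floor_div_natCast, Nat.floor_natCast] at this
            exact this
          calc _ ≤ (Real.log 4 + 4) * (x / b) * (K * f b) :=
                mul_le_mul_of_nonneg_right hpsi (mul_nonneg hK (hf b))
            _ = _ := by ring
      _ = _ := by rw [Finset.mul_sum]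
  calc (∑ c ∈ Finset.Icc 1 x, f c) * (1 + Real.log x)
      ≤ ∑ c ∈ Finset.Icc 1 x, (x * (f c / c) + f c * Real.log c) := by
        rw [Finset.sum_mul]
        exact Finset.sum_le_sum h1
    _ = x * ∑ c ∈ Finset.Icc 1 x, f c / c + ∑ c ∈ Finset.Icc 1 x, f c * Real.log c := by
        rw [Finset.sum_add_distrib, Finset.mul_sum]
    _ ≤ _ := by nlinarith [h2]

theorem sum_Icc_inv_sq_le (x : ℕ) : ∑ a ∈ Finset.Icc 1 x, 1 / (a : ℝ) ^ 2 ≤ 2 := by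
  have key : ∀ x : ℕ, ∑ a ∈ Finset.Icc 1 (x + 1), 1 / (a : ℝ) ^ 2 ≤ 2 - 1 / ((x : ℝ) + 1) := by
    intro x
    induction x with
    | zero => norm_num
    | succ x ih =>
      rw [Finset.sum_Icc_succ_top (by omega)]
      push_cast
      have h1 : 1 / ((x : ℝ) + 1 + 1) ^ 2 ≤ 1 / ((x : ℝ) + 1) - 1 / ((x : ℝ) + 1 + 1) := by
        rw [div_sub_div _ _ (by positivity) (by positivity), div_le_div_iff₀ (by positivity)
          (by positivity)]
        nlinarith [show (0 : ℝ) ≤ x by positivity]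
      linarith
  rcases x with _ | x
  · simp
  · exact (key x).trans (by linarith [show (0 : ℝ) ≤ 1 / ((x : ℝ) + 1) by positivity])

theorem sum_coprime_inv_mul_le (N x : ℕ) (hN : N ≠ 0) :
    (∑ c ∈ Finset.Icc 1 x with Nat.Coprime c N, 1 / (c : ℝ)) * ((N : ℝ) / N.totient) ≤
      2 * (1 + Real.log (x * N)) := by
  have h1 := div_totient_le N hN
  have h2 : (∑ c ∈ Finset.Icc 1 x with Nat.Coprime c N, 1 / (c : ℝ)) *
      ∑ d ∈ N.divisors, 1 / (d : ℝ) ≤ 1 + Real.log (x * N) := by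
    have hinj : Set.InjOn (fun q : ℕ × ℕ => q.1 * q.2)
        (((Finset.Icc 1 x).filter (Nat.Coprime · N)) ×ˢ N.divisors : Finset (ℕ × ℕ)) := by
      rintro ⟨c, d⟩ h ⟨c', d'⟩ h' heq
      simp only [Finset.coe_product, Set.mem_prod, Finset.mem_coe, Finset.mem_filter,
        Finset.mem_Icc, Nat.mem_divisors] at h h' heq
      have e1 : Nat.gcd (c * d) N = d :=
        (Nat.Coprime.gcd_mul_left_cancel d h.1.2).trans (Nat.gcd_eq_left h.2.1)
      have e2 : Nat.gcd (c' * d') N = d' :=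
        (Nat.Coprime.gcd_mul_left_cancel d' h'.1.2).trans (Nat.gcd_eq_left h'.2.1)
      have hd : d = d' := by rw [← e1, ← e2, heq]
      subst hd
      have hd0 : 0 < d := Nat.pos_of_dvd_of_pos h.2.1 (Nat.pos_of_ne_zero hN)
      exact Prod.ext (Nat.eq_of_mul_eq_mul_right hd0 heq) rfl
    have hharm := harmonic_le_one_add_log (x * N)
    rw [harmonic_eq_sum_Icc] at hharm
    push_cast at hharm
    refine le_trans ?_ hharm
    rw [Finset.sum_mul_sum, ← Finset.sum_product']
    calc _ = ∑ q ∈ ((Finset.Icc 1 x).filter (Nat.Coprime · N)) ×ˢ N.divisors,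
          ((q.1 * q.2 : ℕ) : ℝ)⁻¹ := by
          refine Finset.sum_congr rfl fun q _ => ?_
          push_cast
          rw [mul_inv, one_div, one_div]
      _ = ∑ k ∈ (((Finset.Icc 1 x).filter (Nat.Coprime · N)) ×ˢ N.divisors).image
            (fun q : ℕ × ℕ => q.1 * q.2), ((k : ℕ) : ℝ)⁻¹ := (Finset.sum_image (f := fun k : ℕ => (k : ℝ)⁻¹)
              hinj).symm
      _ ≤ _ := by
          refine Finset.sum_le_sum_of_subset_of_nonneg ?_ fun _ _ _ => by positivity
          intro k hk
          obtain ⟨⟨c, d⟩, h, rfl⟩ := Finset.mem_image.1 hk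
          simp only [Finset.mem_product, Finset.mem_filter,
            Finset.mem_Icc, Nat.mem_divisors] at h ⊢
          have hd0 : 0 < d := Nat.pos_of_dvd_of_pos h.2.1 (Nat.pos_of_ne_zero hN)
          exact ⟨Nat.mul_pos h.1.1.1 hd0, Nat.mul_le_mul h.1.1.2
            (Nat.le_of_dvd (Nat.pos_of_ne_zero hN) h.2.1)⟩
  have h0 : (0 : ℝ) ≤ ∑ c ∈ Finset.Icc 1 x with Nat.Coprime c N, 1 / (c : ℝ) :=
    Finset.sum_nonneg fun _ _ => by positivity
  calc _ ≤ (∑ c ∈ Finset.Icc 1 x with Nat.Coprime c N, 1 / (c : ℝ)) *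
        (2 * ∑ d ∈ N.divisors, 1 / (d : ℝ)) := mul_le_mul_of_nonneg_left h1 h0
    _ ≤ _ := by linarith

theorem sum_coprime_div_totient_mul_le (N x : ℕ) (hN : N ≠ 0) (hx : x ≠ 0)
    (hNx : N ≤ 64 * x ^ 2) :
    (∑ c ∈ Finset.Icc 1 x with Nat.Coprime c N, (c : ℝ) / c.totient) * N ≤
      48 * (1 + 2 * (Real.log 4 + 4)) * x * N.totient := by
  set f : ℕ → ℝ := fun c => if Nat.Coprime c N then (c : ℝ) / c.totient else 0 with hf
  have hf0 : ∀ n, 0 ≤ f n := fun n => by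
    simp only [hf]
    split_ifs <;> positivity
  have hsub : ∀ a b : ℕ, IsPrimePow a → b ≠ 0 → f (a * b) ≤ 2 * f b := by
    intro a b ha hb
    simp only [hf]
    split_ifs with h1 h2
    · have hb0 : (0 : ℝ) < b := by exact_mod_cast Nat.pos_of_ne_zero hb
      have ha0 : (0 : ℝ) < a := by exact_mod_cast ha.pos
      have hφb : (0 : ℝ) < b.totient := by
        exact_mod_cast Nat.totient_pos.2 (Nat.pos_of_ne_zero hb)
      have hφa : (0 : ℝ) < a.totient := by exact_mod_cast Nat.totient_pos.2 ha.pos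
      have hmul : (a.totient : ℝ) * b.totient ≤ (a * b).totient := by
        exact_mod_cast Nat.totient_super_multiplicative a b
      have ha2 : (a : ℝ) ≤ 2 * a.totient := by
        obtain ⟨q, k, hq, hk, rfl⟩ := (isPrimePow_nat_iff a).1 ha
        rw [Nat.totient_prime_pow hq hk]
        obtain ⟨k, rfl⟩ := Nat.exists_eq_succ_of_ne_zero hk.ne'
        have := hq.two_le
        have h3 : q ≤ 2 * (q - 1) := by omega
        have h4 : q ^ (k + 1) ≤ 2 * (q ^ k * (q - 1)) := by
          rw [pow_succ]
          nlinarith [Nat.zero_le (q ^ k), Nat.mul_le_mul_left (q ^ k) h3]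
        exact_mod_cast h4
      push_cast
      calc (a : ℝ) * b / (a * b).totient ≤ a * b / (a.totient * b.totient) :=
            div_le_div_of_nonneg_left (by positivity) (by positivity) hmul
        _ = a / a.totient * (b / b.totient) := by rw [mul_div_mul_comm]
        _ ≤ 2 * (b / b.totient) := by
            refine mul_le_mul_of_nonneg_right ?_ (by positivity)
            rwa [div_le_iff₀ hφa]
    · exact absurd (h1.coprime_dvd_left (Dvd.intro_left a rfl)) h2
    · positivity
    · simp
  have h1 := sum_mul_one_add_log_le f hf0 2 (by norm_num) hsub x
  have hA := sum_coprime_inv_mul_le N x hN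
  set A := ∑ c ∈ Finset.Icc 1 x with Nat.Coprime c N, 1 / (c : ℝ) with hAdef
  have h2 : ∑ c ∈ Finset.Icc 1 x, f c / c ≤ 4 * A := by
    set g : ℕ → ℝ := fun b => if Nat.Coprime b N then 1 / (b : ℝ) else 0 with hg
    have hg0 : ∀ b, 0 ≤ g b := fun b => by
      simp only [hg]
      split_ifs <;> positivity
    calc ∑ c ∈ Finset.Icc 1 x, f c / c
        ≤ ∑ c ∈ Finset.Icc 1 x, ∑ q ∈ c.divisorsAntidiagonal,
            2 * (1 / (q.1 : ℝ) ^ 2) * g q.2 := by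
          refine Finset.sum_le_sum fun c hc => ?_
          have hc0 : c ≠ 0 := by
            have := (Finset.mem_Icc.1 hc).1
            omega
          simp only [hf]
          split_ifs with hcop
          · have h3 := div_totient_le c hc0
            rw [← Nat.sum_divisorsAntidiagonal fun a _ => 1 / (a : ℝ)] at h3
            calc (c : ℝ) / c.totient / c
                ≤ (2 * ∑ q ∈ c.divisorsAntidiagonal, 1 / (q.1 : ℝ)) / c :=
                  div_le_div_of_nonneg_right h3 (by positivity)
              _ = ∑ q ∈ c.divisorsAntidiagonal, 2 * (1 / (q.1 : ℝ)) / c := by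
                  rw [Finset.mul_sum, Finset.sum_div]
              _ = _ := by
                  refine Finset.sum_congr rfl fun q hq => ?_
                  obtain ⟨hq1, -⟩ := Nat.mem_divisorsAntidiagonal.1 hq
                  have : Nat.Coprime q.2 N := hcop.coprime_dvd_left (Dvd.intro_left q.1 hq1)
                  simp only [hg, if_pos this]
                  rw [← hq1]
                  push_cast
                  rw [mul_div_assoc, div_div, mul_assoc, div_mul_div_comm]
                  ring_nf
          · rw [zero_div]
            exact Finset.sum_nonneg fun q _ => mul_nonneg (by positivity) (hg0 _)
      _ = ∑ b ∈ Finset.Icc 1 x, ∑ a ∈ Finset.Icc 1 (x / b), 2 * (1 / (a : ℝ) ^ 2) * g b :=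
          sum_Icc_sum_divisorsAntidiagonal x fun a b => 2 * (1 / (a : ℝ) ^ 2) * g b
      _ ≤ ∑ b ∈ Finset.Icc 1 x, 4 * g b := by
          refine Finset.sum_le_sum fun b _ => ?_
          rw [← Finset.sum_mul, ← Finset.mul_sum]
          refine mul_le_mul_of_nonneg_right ?_ (hg0 b)
          linarith [sum_Icc_inv_sq_le (x / b)]
      _ = 4 * A := by rw [← Finset.mul_sum, hAdef, Finset.sum_filter]
  have hS : ∑ c ∈ Finset.Icc 1 x with Nat.Coprime c N, (c : ℝ) / c.totient =
      ∑ c ∈ Finset.Icc 1 x, f c := by rw [Finset.sum_filter]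
  rw [hS]
  have hx1 : (1 : ℝ) ≤ x := by exact_mod_cast Nat.one_le_iff_ne_zero.2 hx
  have hN1 : (0 : ℝ) < N := by exact_mod_cast Nat.pos_of_ne_zero hN
  have hφ : (0 : ℝ) < N.totient := by exact_mod_cast Nat.totient_pos.2 (Nat.pos_of_ne_zero hN)
  have hlog : 0 ≤ Real.log x := Real.log_nonneg hx1
  have hlog4 : 0 ≤ Real.log 4 := Real.log_nonneg (by norm_num)
  have h3 : Real.log (x * N) ≤ 5 + 3 * Real.log x := by
    have : Real.log (x * N) ≤ Real.log (2 ^ 6 * (x : ℝ) ^ 3) := by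
      refine Real.log_le_log (by positivity) ?_
      have : (N : ℝ) ≤ 64 * (x : ℝ) ^ 2 := by exact_mod_cast hNx
      nlinarith
    rw [Real.log_mul (x := 2 ^ 6) (by positivity) (by positivity), Real.log_pow,
      Real.log_pow] at this
    push_cast at this
    linarith [Real.log_two_lt_d9]
  have h4 : A * N ≤ 12 * (1 + Real.log x) * N.totient := by
    rw [← mul_div_assoc, div_le_iff₀ hφ] at hA
    refine hA.trans (mul_le_mul_of_nonneg_right ?_ hφ.le)
    linarith
  refine le_of_mul_le_mul_right ?_ (show 0 < 1 + Real.log x by linarith)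
  calc (∑ c ∈ Finset.Icc 1 x, f c) * N * (1 + Real.log x)
      = (∑ c ∈ Finset.Icc 1 x, f c) * (1 + Real.log x) * N := by ring
    _ ≤ (1 + 2 * (Real.log 4 + 4)) * x * (4 * A) * N :=
        mul_le_mul_of_nonneg_right (h1.trans (mul_le_mul_of_nonneg_left h2 (by positivity)))
          hN1.le
    _ = (1 + 2 * (Real.log 4 + 4)) * x * 4 * (A * N) := by ring
    _ ≤ (1 + 2 * (Real.log 4 + 4)) * x * 4 * (12 * (1 + Real.log x) * N.totient) :=
        mul_le_mul_of_nonneg_left h4 (by positivity)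
    _ = _ := by ring

/-- The number of units `u` modulo `g` such that `u - c` is a unit too. -/
def unitShiftCount (g : ℕ) (c : ℤ) : ℕ :=
  Nat.card {u : ZMod g // IsUnit u ∧ IsUnit (u - (c : ZMod g))}

theorem unitShiftCount_mul_le {r a : ℕ} (hr : r ≠ 0) (ha : a ≠ 0) (h : r.Coprime a) (c : ℤ) :
    unitShiftCount (r * a) c ≤ unitShiftCount r c * unitShiftCount a c := by
  have : NeZero r := ⟨hr⟩
  have : NeZero a := ⟨ha⟩
  rw [unitShiftCount, unitShiftCount, unitShiftCount, ← Nat.card_prod]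
  let e := ZMod.chineseRemainder h
  let f₁ : ZMod (r * a) →+* ZMod r := (RingHom.fst _ _).comp e.toRingHom
  let f₂ : ZMod (r * a) →+* ZMod a := (RingHom.snd _ _).comp e.toRingHom
  refine Nat.card_le_card_of_injective (fun u =>
    (⟨f₁ u.1, u.2.1.map f₁, by simpa using u.2.2.map f₁⟩,
      ⟨f₂ u.1, u.2.1.map f₂, by simpa using u.2.2.map f₂⟩)) ?_
  rintro ⟨u, hu⟩ ⟨v, hv⟩ huv
  have h1 : f₁ u = f₁ v := congrArg (fun w => w.1.1) huv
  have h2 : f₂ u = f₂ v := congrArg (fun w => w.2.1) huv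
  exact Subtype.ext (e.injective (Prod.ext h1 h2))

theorem unitShiftCount_prime_mul_le {r : ℕ} (hr : r.Prime) (c : ℤ) :
    (unitShiftCount r c : ℝ) * r ≤
      (r.totient : ℝ) ^ 2 * if (r : ℤ) ∣ c then (r : ℝ) / (r - 1) else 1 := by
  classical
  have : Fact r.Prime := ⟨hr⟩
  have hr2 := hr.two_le
  have hr2' : (2 : ℝ) ≤ r := by exact_mod_cast hr2
  have hcount : unitShiftCount r c = r - ({0, (c : ZMod r)} : Finset (ZMod r)).card := by
    have hcompl := Finset.card_compl ({0, (c : ZMod r)} : Finset (ZMod r))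
    rw [ZMod.card] at hcompl
    rw [unitShiftCount, Nat.card_eq_fintype_card, Fintype.card_subtype, ← hcompl]
    congr 1
    ext u
    simp [sub_eq_zero]
  rw [Nat.totient_prime hr, Nat.cast_sub (by omega), hcount]
  split_ifs with h
  · have : (c : ZMod r) = 0 := (ZMod.intCast_zmod_eq_zero_iff_dvd c r).2 h
    rw [this]
    simp only [Finset.pair_eq_singleton, Finset.card_singleton]
    rw [Nat.cast_sub (by omega)]
    have : (r : ℝ) - 1 ≠ 0 := by linarith
    push_cast
    field_simp
    exact le_refl _
  · have : (0 : ZMod r) ≠ (c : ZMod r) := fun h' =>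
      h ((ZMod.intCast_zmod_eq_zero_iff_dvd c r).1 h'.symm)
    rw [Finset.card_pair this, Nat.cast_sub hr2]
    push_cast
    nlinarith

theorem unitShiftCount_mul_le_prod (g : ℕ) (c : ℤ) :
    Squarefree g → (unitShiftCount g c : ℝ) * g ≤ (g.totient : ℝ) ^ 2 *
      ∏ r ∈ g.primeFactors, if (r : ℤ) ∣ c then (r : ℝ) / (r - 1) else 1 := by
  induction g using induction_on_primes with
  | zero => exact fun h => absurd h not_squarefree_zero
  | one =>
    intro _
    have : unitShiftCount 1 c ≤ 1 := by
      refine (Nat.card_le_card_of_injective Subtype.val Subtype.val_injective).trans ?_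
      simp
    simpa using this
  | prime_mul r a hr ih =>
    intro hsq
    obtain ⟨hcop, -, hsqa⟩ := Nat.squarefree_mul_iff.1 hsq
    have ha := hsqa.ne_zero
    have h1 : (unitShiftCount (r * a) c : ℝ) ≤ unitShiftCount r c * unitShiftCount a c := by
      exact_mod_cast unitShiftCount_mul_le hr.ne_zero ha hcop c
    rw [Nat.totient_mul hcop, hcop.primeFactors_mul,
      Finset.prod_union hcop.disjoint_primeFactors, hr.primeFactors, Finset.prod_singleton]
    push_cast
    have hnn : ∀ q : ℕ, q ∈ a.primeFactors →
        0 ≤ (if (q : ℤ) ∣ c then (q : ℝ) / (q - 1) else 1) := by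
      intro q hq
      have : (2 : ℝ) ≤ q := by exact_mod_cast (Nat.prime_of_mem_primeFactors hq).two_le
      split_ifs
      · exact div_nonneg (by linarith) (by linarith)
      · norm_num
    calc (unitShiftCount (r * a) c : ℝ) * (r * a)
        ≤ unitShiftCount r c * unitShiftCount a c * (r * a) :=
          mul_le_mul_of_nonneg_right h1 (by positivity)
      _ = (unitShiftCount r c * r) * (unitShiftCount a c * a) := by ring
      _ ≤ _ := mul_le_mul (unitShiftCount_prime_mul_le hr c) (ih hsqa) (by positivity)
          ((by positivity : (0 : ℝ) ≤ unitShiftCount r c * r).trans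
            (unitShiftCount_prime_mul_le hr c))
      _ = _ := by ring

theorem unitShiftCount_mul_le_div_totient {g : ℕ} (hg : Squarefree g) {c : ℤ} (hc : c ≠ 0) :
    (unitShiftCount g c : ℝ) * g ≤
      (g.totient : ℝ) ^ 2 * ((c.natAbs : ℝ) / c.natAbs.totient) := by
  refine (unitShiftCount_mul_le_prod g c hg).trans
    (mul_le_mul_of_nonneg_left ?_ (by positivity))
  have hc' : c.natAbs ≠ 0 := Int.natAbs_ne_zero.2 hc
  have h2 : ∀ q ∈ c.natAbs.primeFactors, (2 : ℝ) ≤ q := fun q hq => by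
    exact_mod_cast (Nat.prime_of_mem_primeFactors hq).two_le
  have h1 : (c.natAbs : ℝ) / c.natAbs.totient =
      ∏ r ∈ c.natAbs.primeFactors, (r : ℝ) / (r - 1) := by
    rw [← inv_div, totient_div_eq_prod _ hc', ← Finset.prod_inv_distrib]
    refine Finset.prod_congr rfl fun q hq => ?_
    have := h2 q hq
    rw [one_sub_div (by linarith), inv_div]
  rw [h1, ← Finset.prod_filter]
  refine Finset.prod_le_prod_of_subset_of_one_le ?_ ?_ ?_
  · intro q hq
    obtain ⟨hq1, hq2⟩ := Finset.mem_filter.1 hq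
    exact Nat.mem_primeFactors.2
      ⟨Nat.prime_of_mem_primeFactors hq1, Int.natCast_dvd.1 hq2, hc'⟩
  · intro q hq
    have : (2 : ℝ) ≤ q := by
      exact_mod_cast (Nat.prime_of_mem_primeFactors (Finset.mem_filter.1 hq).1).two_le
    exact div_nonneg (by linarith) (by linarith)
  · intro q hq _
    have := h2 q hq
    rw [one_le_div (by linarith)]
    linarith

open Classical in
/-- The points of additive order `n` on the circle `ℝ/ℤ`. -/
def orderPoints (n : ℕ) : Finset UnitAddCircle :=
  ((Finset.range n).filter (Nat.Coprime · n)).image fun a => ((a / n : ℝ) : UnitAddCircle)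

theorem mem_orderPoints_iff_exists {n : ℕ} {b : UnitAddCircle} :
    b ∈ orderPoints n ↔ ∃ a < n, Nat.Coprime a n ∧ ((a / n : ℝ) : UnitAddCircle) = b := by
  simp [orderPoints, and_assoc]

theorem mem_orderPoints {n : ℕ} {b : UnitAddCircle} :
    b ∈ orderPoints n ↔ 0 < n ∧ addOrderOf b = n := by
  rw [mem_orderPoints_iff_exists]
  rcases n.eq_zero_or_pos with rfl | hn
  · simp
  · rw [AddCircle.addOrderOf_eq_pos_iff hn]
    simp [hn, Nat.Coprime]

theorem card_orderPoints (n : ℕ) : (orderPoints n).card = n.totient := by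
  rcases n.eq_zero_or_pos with rfl | hn
  · simp [orderPoints]
  · rw [← AddCircle.card_addOrderOf_eq_totient (1 : ℝ), ← Nat.card_eq_finsetCard]
    exact Nat.card_congr (Equiv.subtypeEquivRight fun b => by rw [mem_orderPoints]; simp [hn])

theorem card_coprime_pairs_le {g m n : ℕ} (hgm : g.Coprime m) (hgn : g.Coprime n)
    (hmn : m.Coprime n) (hg : g ≠ 0) (c : ℤ) :
    (((Finset.range (g * m) ×ˢ Finset.range (g * n)).filter fun q =>
      q.1.Coprime (g * m) ∧ q.2.Coprime (g * n) ∧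
        ((g * m * n : ℕ) : ℤ) ∣ q.1 * n - q.2 * m - c).card) ≤
      if c.natAbs.Coprime (m * n) then unitShiftCount g c else 0 := by
  have : NeZero g := ⟨hg⟩
  set T := (Finset.range (g * m) ×ˢ Finset.range (g * n)).filter fun q : ℕ × ℕ =>
      q.1.Coprime (g * m) ∧ q.2.Coprime (g * n) ∧
        ((g * m * n : ℕ) : ℤ) ∣ q.1 * n - q.2 * m - c with hT
  have hmem : ∀ q ∈ T, (q.1 < g * m ∧ q.2 < g * n) ∧ (q.1.Coprime (g * m) ∧
      q.2.Coprime (g * n) ∧ ((g * m * n : ℕ) : ℤ) ∣ q.1 * n - q.2 * m - c) := by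
    intro q hq
    simpa [hT, Finset.mem_filter, Finset.mem_product] using hq
  have hdg : ∀ q ∈ T, (g : ℤ) ∣ q.1 * n - q.2 * m - c := fun q hq =>
    (Int.natCast_dvd_natCast.2 ⟨m * n, by ring⟩).trans (hmem q hq).2.2.2
  have hdm : ∀ q ∈ T, (m : ℤ) ∣ q.1 * n - c := by
    intro q hq
    have h1 : (m : ℤ) ∣ q.1 * n - q.2 * m - c :=
      (Int.natCast_dvd_natCast.2 ⟨g * n, by ring⟩).trans (hmem q hq).2.2.2
    rw [show (q.1 * n - c : ℤ) = q.1 * n - q.2 * m - c + q.2 * m by ring]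
    exact dvd_add h1 (Dvd.intro_left _ rfl)
  have hdn : ∀ q ∈ T, (n : ℤ) ∣ q.2 * m + c := by
    intro q hq
    have h1 : (n : ℤ) ∣ q.1 * n - q.2 * m - c :=
      (Int.natCast_dvd_natCast.2 ⟨g * m, by ring⟩).trans (hmem q hq).2.2.2
    rw [show (q.2 * m + c : ℤ) = q.1 * n - (q.1 * n - q.2 * m - c) by ring]
    exact dvd_sub (Dvd.intro_left _ rfl) h1
  split_ifs with hc
  · rw [unitShiftCount, ← Nat.card_eq_finsetCard]
    have hu : ∀ q : T, IsUnit (((q.1.1 * n : ℕ)) : ZMod g) ∧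
        IsUnit (((q.1.1 * n : ℕ) : ZMod g) - (c : ZMod g)) := by
      rintro ⟨q, hq⟩
      obtain ⟨-, h1, h2, -⟩ := hmem q hq
      refine ⟨(ZMod.isUnit_iff_coprime _ _).2
        (Nat.Coprime.mul_left (h1.coprime_dvd_right (Dvd.intro _ rfl)) hgn.symm), ?_⟩
      have : ((q.1 * n : ℕ) : ZMod g) - (c : ZMod g) = ((q.2 * m : ℕ) : ZMod g) := by
        have h3 := (ZMod.intCast_zmod_eq_zero_iff_dvd _ g).2 (hdg q hq)
        push_cast at h3 ⊢
        linear_combination h3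
      rw [this]
      exact (ZMod.isUnit_iff_coprime _ _).2
        (Nat.Coprime.mul_left (h2.coprime_dvd_right (Dvd.intro _ rfl)) hgm.symm)
    refine Nat.card_le_card_of_injective (fun q : T => ⟨_, hu q⟩) ?_
    rintro ⟨q, hq⟩ ⟨q', hq'⟩ h
    have h1 : ((q.1 * n : ℕ) : ZMod g) = ((q'.1 * n : ℕ) : ZMod g) := congrArg Subtype.val h
    have hg1 : (g : ℤ) ∣ (q.1 - q'.1) * n := by
      refine (ZMod.intCast_zmod_eq_zero_iff_dvd _ g).1 ?_
      push_cast at h1 ⊢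
      linear_combination h1
    have hm1 : (m : ℤ) ∣ (q.1 - q'.1) * n := by
      rw [show ((q.1 - q'.1) * n : ℤ) = q.1 * n - c - (q'.1 * n - c) by ring]
      exact dvd_sub (hdm q hq) (hdm q' hq')
    have hgn' : IsCoprime (g : ℤ) n := Nat.isCoprime_iff_coprime.2 hgn
    have hmn' : IsCoprime (m : ℤ) n := Nat.isCoprime_iff_coprime.2 hmn
    have hgm' : IsCoprime (g : ℤ) m := Nat.isCoprime_iff_coprime.2 hgm
    have hd : ((g * m : ℕ) : ℤ) ∣ q.1 - q'.1 := by
      push_cast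
      exact hgm'.mul_dvd (hgn'.dvd_of_dvd_mul_right hg1) (hmn'.dvd_of_dvd_mul_right hm1)
    have e1 : q.1 = q'.1 := by
      have := Int.eq_zero_of_abs_lt_dvd hd (by
        have h3 := (hmem q hq).1.1
        have h4 := (hmem q' hq').1.1
        rw [abs_lt]
        constructor <;> omega)
      omega
    have hd2 : ((g * n : ℕ) : ℤ) ∣ q.2 - q'.2 := by
      have h5 := dvd_sub (hmem q' hq').2.2.2 (hmem q hq).2.2.2
      rw [e1] at h5
      have h6 : ((g * n : ℕ) : ℤ) * m ∣ (q.2 - q'.2) * m := by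
        rw [show ((g * n : ℕ) : ℤ) * m = (g * m * n : ℕ) by push_cast; ring,
          show ((q.2 - q'.2) * m : ℤ) = q'.1 * n - q'.2 * m - c - (q'.1 * n - q.2 * m - c) by ring]
        exact h5
      have hm0 : (m : ℤ) ≠ 0 := by
        rintro h0
        have := (hmem q hq).1.1
        have h7 : m = 0 := by exact_mod_cast h0
        simp [h7] at this
      exact Int.dvd_of_mul_dvd_mul_right hm0 h6
    have e2 : q.2 = q'.2 := by
      have := Int.eq_zero_of_abs_lt_dvd hd2 (by
        have h3 := (hmem q hq).1.2
        have h4 := (hmem q' hq').1.2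
        rw [abs_lt]
        constructor <;> omega)
      omega
    exact Subtype.ext (Prod.ext e1 e2)
  · rw [Nat.le_zero, Finset.card_eq_zero, Finset.eq_empty_iff_forall_notMem]
    intro q hq
    refine hc (Nat.Coprime.mul_right ?_ ?_)
    · have h1 : IsCoprime ((q.1 * n : ℕ) : ℤ) m := Nat.isCoprime_iff_coprime.2
        (Nat.Coprime.mul_left ((hmem q hq).2.1.coprime_dvd_right (Dvd.intro_left _ rfl)) hmn.symm)
      obtain ⟨k, hk⟩ := hdm q hq
      have h2 : c = ((q.1 * n : ℕ) : ℤ) + m * (-k) := by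
        push_cast
        linarith
      have h3 : IsCoprime c m := by
        rw [h2]
        exact h1.add_mul_left_left _
      simpa using Int.isCoprime_iff_nat_coprime.1 h3
    · have h1 : IsCoprime ((q.2 * m : ℕ) : ℤ) n := Nat.isCoprime_iff_coprime.2
        (Nat.Coprime.mul_left ((hmem q hq).2.2.1.coprime_dvd_right (Dvd.intro_left _ rfl)) hmn)
      obtain ⟨k, hk⟩ := hdn q hq
      have h2 : -c = ((q.2 * m : ℕ) : ℤ) + n * (-k) := by
        push_cast
        linarith
      have h3 : IsCoprime (-c) n := by
        rw [h2]
        exact h1.add_mul_left_left _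
      simpa using Int.isCoprime_iff_nat_coprime.1 h3

open Classical in
theorem card_near_pairs_mul_le {g m n : ℕ} (hg : Squarefree g) (hgm : g.Coprime m)
    (hgn : g.Coprime n) (hmn : m.Coprime n) {R : ℝ} (hm : 1 / 4 ≤ (g * m : ℕ) * R)
    (hn : 1 / 4 ≤ (g * n : ℕ) * R) :
    (((orderPoints (g * m) ×ˢ orderPoints (g * n)).filter fun q =>
      q.1 ≠ q.2 ∧ ‖q.1 - q.2‖ ≤ R).card : ℝ) ≤
      2 * (48 * (1 + 2 * (Real.log 4 + 4))) * (g * m).totient * (g * n).totient * R := by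
  have hlog4 : 0 ≤ Real.log 4 := Real.log_nonneg (by norm_num)
  set K : ℝ := 48 * (1 + 2 * (Real.log 4 + 4)) with hK
  have hg0 : (0 : ℝ) < g := by exact_mod_cast Nat.pos_of_ne_zero hg.ne_zero
  have hm0 : m ≠ 0 := by
    rintro rfl
    norm_num at hm
  have hn0 : n ≠ 0 := by
    rintro rfl
    norm_num at hn
  have hm0' : (0 : ℝ) < m := by exact_mod_cast Nat.pos_of_ne_zero hm0
  have hn0' : (0 : ℝ) < n := by exact_mod_cast Nat.pos_of_ne_zero hn0
  have hR : 0 < R := by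
    by_contra! hR
    have := mul_nonpos_of_nonneg_of_nonpos (Nat.cast_nonneg (α := ℝ) (g * m)) hR
    linarith
  set L : ℝ := g * m * n with hL
  have hL0 : 0 < L := by positivity
  set x : ℕ := ⌊L * R⌋₊ with hx
  set T : ℤ → Finset (ℕ × ℕ) := fun c =>
    (Finset.range (g * m) ×ˢ Finset.range (g * n)).filter fun q =>
      q.1.Coprime (g * m) ∧ q.2.Coprime (g * n) ∧
        ((g * m * n : ℕ) : ℤ) ∣ q.1 * n - q.2 * m - c with hT
  set F : ℕ × ℕ → UnitAddCircle × UnitAddCircle := fun q =>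
    (((q.1 / (g * m : ℕ) : ℝ) : UnitAddCircle), ((q.2 / (g * n : ℕ) : ℝ) : UnitAddCircle)) with hF
  have hsub : ((orderPoints (g * m) ×ˢ orderPoints (g * n)).filter fun q =>
      q.1 ≠ q.2 ∧ ‖q.1 - q.2‖ ≤ R) ⊆
      (Finset.Icc 1 x).biUnion fun k => (T k).image F ∪ (T (-k)).image F := by
    rintro ⟨a, b⟩ hab
    obtain ⟨h1, hne, hle⟩ := Finset.mem_filter.1 hab
    obtain ⟨ha, hb⟩ := Finset.mem_product.1 h1
    obtain ⟨α, hα, hαc, rfl⟩ := mem_orderPoints_iff_exists.1 ha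
    obtain ⟨β, hβ, hβc, rfl⟩ := mem_orderPoints_iff_exists.1 hb
    set y : ℝ := (α / (g * m : ℕ) : ℝ) - (β / (g * n : ℕ) : ℝ) with hy
    have hnorm : ‖(((α / (g * m : ℕ) : ℝ) : UnitAddCircle) -
        ((β / (g * n : ℕ) : ℝ) : UnitAddCircle))‖ = |y - round y| := by
      rw [← AddCircle.coe_sub, UnitAddCircle.norm_eq]
    set c : ℤ := α * n - β * m - (g * m * n : ℕ) * round y with hc
    have hcy : (c : ℝ) = L * (y - round y) := by
      rw [hc, hy, hL]
      push_cast
      field_simp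
    have hcabs : (c.natAbs : ℝ) = L * |y - round y| := by
      rw [Nat.cast_natAbs, Int.cast_abs, hcy, abs_mul, abs_of_pos hL0]
    have hc1 : 1 ≤ c.natAbs := by
      rw [Nat.one_le_iff_ne_zero]
      intro h0
      rw [h0, Nat.cast_zero] at hcabs
      have h2 : |y - round y| = 0 := by
        rcases mul_eq_zero.1 hcabs.symm with h | h
        · exact absurd h hL0.ne'
        · exact h
      rw [h2, norm_sub_eq_zero_iff] at hnorm
      exact hne hnorm
    have hcx : c.natAbs ≤ x := by
      refine Nat.le_floor ?_
      rw [hcabs, ← hnorm]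
      exact mul_le_mul_of_nonneg_left hle hL0.le
    refine Finset.mem_biUnion.2 ⟨c.natAbs, Finset.mem_Icc.2 ⟨hc1, hcx⟩, ?_⟩
    have hmemT : (α, β) ∈ T c := by
      simp only [hT, Finset.mem_filter, Finset.mem_product, Finset.mem_range]
      exact ⟨⟨hα, hβ⟩, hαc, hβc, ⟨round y, by rw [hc]; ring⟩⟩
    rcases Int.natAbs_eq c with h | h
    · exact Finset.mem_union_left _ (Finset.mem_image.2 ⟨(α, β), h ▸ hmemT, rfl⟩)
    · exact Finset.mem_union_right _ (Finset.mem_image.2 ⟨(α, β), h ▸ hmemT, rfl⟩)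
  have hTle : ∀ c : ℤ, c ≠ 0 → ((T c).card : ℝ) ≤
      if c.natAbs.Coprime (m * n) then
        (g.totient : ℝ) ^ 2 / g * ((c.natAbs : ℝ) / c.natAbs.totient) else 0 := by
    intro c hc
    have h1 := card_coprime_pairs_le hgm hgn hmn hg.ne_zero c
    split_ifs at h1 ⊢ with h
    · calc ((T c).card : ℝ) ≤ unitShiftCount g c := Nat.cast_le.2 h1
        _ ≤ _ := by
          rw [div_mul_eq_mul_div, le_div_iff₀ hg0]
          exact unitShiftCount_mul_le_div_totient hg hc
    · exact (Nat.cast_le.2 h1).trans Nat.cast_zero.le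
  have hcard : (((orderPoints (g * m) ×ˢ orderPoints (g * n)).filter fun q =>
      q.1 ≠ q.2 ∧ ‖q.1 - q.2‖ ≤ R).card : ℝ) ≤ 2 * ((g.totient : ℝ) ^ 2 / g *
        ∑ k ∈ Finset.Icc 1 x with Nat.Coprime k (m * n), (k : ℝ) / k.totient) := by
    have h1 := (Finset.card_le_card hsub).trans Finset.card_biUnion_le
    calc _ ≤ ((∑ k ∈ Finset.Icc 1 x, ((T k).image F ∪ (T (-k)).image F).card : ℕ) : ℝ) := by
          exact_mod_cast h1
      _ ≤ ∑ k ∈ Finset.Icc 1 x, 2 * (if k.Coprime (m * n) then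
            (g.totient : ℝ) ^ 2 / g * ((k : ℝ) / k.totient) else 0) := by
          push_cast
          refine Finset.sum_le_sum fun k hk => ?_
          have hk0 : (k : ℤ) ≠ 0 := by
            have := (Finset.mem_Icc.1 hk).1
            omega
          have h2 := hTle k hk0
          have h3 := hTle (-k) (neg_ne_zero.2 hk0)
          rw [Int.natAbs_neg] at h3
          rw [Int.natAbs_natCast] at h2 h3
          have h4 : ((((T k).image F ∪ (T (-k)).image F).card : ℕ) : ℝ) ≤
              (T k).card + (T (-k)).card := by
            exact_mod_cast (Finset.card_union_le _ _).trans
              (add_le_add Finset.card_image_le Finset.card_image_le)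
          linarith
      _ = _ := by
          rw [← Finset.mul_sum, ← Finset.sum_filter, ← Finset.mul_sum]
  refine hcard.trans ?_
  rcases Nat.eq_zero_or_pos x with hx0 | hxpos
  · rw [hx0]
    simp only [Finset.Icc_eq_empty (by norm_num : ¬ (1 ≤ 0)), Finset.filter_empty,
      Finset.sum_empty, mul_zero]
    positivity
  have hxle : (x : ℝ) ≤ L * R := Nat.floor_le (by positivity)
  have hxgt : L * R < x + 1 := Nat.lt_floor_add_one _
  have hx1 : (1 : ℝ) ≤ x := by exact_mod_cast hxpos
  have hNx : m * n ≤ 64 * x ^ 2 := by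
    have h1 : (1 / 4 : ℝ) * (1 / 4) ≤ ((g * m : ℕ) * R) * ((g * n : ℕ) * R) :=
      mul_le_mul hm hn (by norm_num) (by positivity)
    have h2 : (m * n : ℝ) ≤ 16 * (L * R) ^ 2 := by
      have h3 : (L * R) ^ 2 = (m * n) * (((g * m : ℕ) * R) * ((g * n : ℕ) * R)) := by
        rw [hL]
        push_cast
        ring
      rw [h3]
      nlinarith [mul_pos hm0' hn0']
    have h4 : (L * R) ^ 2 ≤ (2 * x) ^ 2 := pow_le_pow_left₀ (by positivity) (by linarith) 2
    have h5 : (m * n : ℝ) ≤ 64 * x ^ 2 := by nlinarith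
    exact_mod_cast h5
  have hsieve := sum_coprime_div_totient_mul_le (m * n) x (Nat.mul_ne_zero hm0 hn0) hxpos.ne' hNx
  rw [Nat.totient_mul hgm, Nat.totient_mul hgn]
  rw [Nat.totient_mul hmn] at hsieve
  set S := ∑ k ∈ Finset.Icc 1 x with Nat.Coprime k (m * n), (k : ℝ) / k.totient
  push_cast at hsieve ⊢
  have h6 : S ≤ K * (g * R) * (m.totient * n.totient) := by
    refine le_of_mul_le_mul_right (hsieve.trans ?_) (mul_pos hm0' hn0')
    calc K * x * (m.totient * n.totient) ≤ K * (L * R) * (m.totient * n.totient) := by gcongr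
      _ = _ := by
        rw [hL]
        ring
  calc 2 * ((g.totient : ℝ) ^ 2 / g * S)
      ≤ 2 * ((g.totient : ℝ) ^ 2 / g * (K * (g * R) * (m.totient * n.totient))) := by gcongr
    _ = _ := by
      field_simp

open Classical in
theorem card_near_pairs_le {m n : ℕ} (hm : Squarefree m) (hn : Squarefree n) {R : ℝ}
    (hmR : 1 / 4 ≤ m * R) (hnR : 1 / 4 ≤ n * R) :
    (((orderPoints m ×ˢ orderPoints n).filter fun q => q.1 ≠ q.2 ∧ ‖q.1 - q.2‖ ≤ R).card : ℝ) ≤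
      2 * (48 * (1 + 2 * (Real.log 4 + 4))) * m.totient * n.totient * R := by
  obtain ⟨m', n', hcop, hm', hn'⟩ := Nat.exists_coprime m n
  rw [mul_comm] at hm' hn'
  set g := m.gcd n
  have h1 := Nat.squarefree_mul_iff.1 (hm' ▸ hm)
  have h2 := Nat.squarefree_mul_iff.1 (hn' ▸ hn)
  rw [hm'] at hmR ⊢
  rw [hn'] at hnR ⊢
  exact card_near_pairs_mul_le h1.2.1 h1.1 h2.1 hcop hmR hnR

theorem lintegral_sq_le {α : Type*} [MeasurableSpace α] (ν : Measure α) {F : α → ENNReal}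
    (hF : Measurable F) {U : Set α} (hU : MeasurableSet U) (hFU : ∀ x ∉ U, F x = 0) :
    (∫⁻ x, F x ∂ν) ^ 2 ≤ (∫⁻ x, F x * F x ∂ν) * ν U := by
  have h1 : ∫⁻ x, F x ∂ν = ∫⁻ x, (F * U.indicator (1 : α → ENNReal)) x ∂ν := by
    refine lintegral_congr fun x => ?_
    by_cases hx : x ∈ U
    · simp [hx]
    · simp [hx, hFU x hx]
  have h2 := ENNReal.lintegral_mul_le_Lp_mul_Lq ν Real.HolderConjugate.two_two hF.aemeasurable
    ((measurable_one.indicator hU).aemeasurable : AEMeasurable (U.indicator (1 : α → ENNReal)) ν)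
  rw [← h1] at h2
  have h3 : ∫⁻ x, (U.indicator (1 : α → ENNReal) x) ^ (2 : ℝ) ∂ν = ν U := by
    rw [← lintegral_indicator_one hU]
    refine lintegral_congr fun x => ?_
    by_cases hx : x ∈ U <;> simp [hx]
  have h4 : ∫⁻ x, F x ^ (2 : ℝ) ∂ν = ∫⁻ x, F x * F x ∂ν := by
    refine lintegral_congr fun x => ?_
    rw [ENNReal.rpow_two, sq]
  rw [h3, h4] at h2
  have hsq : ∀ a : ENNReal, (a ^ (1 / (2 : ℝ))) ^ 2 = a := fun a => by
    rw [← ENNReal.rpow_two, ← ENNReal.rpow_mul]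
    norm_num
  calc _ ≤ _ := pow_le_pow_left₀ zero_le h2 2
    _ = _ := by rw [mul_pow, hsq, hsq]

theorem tendsto_sum_Icc_one {a : ℕ → ENNReal} (h0 : a 0 = 0) (ha : ∑' n, a n = ⊤) :
    Tendsto (fun N => ∑ n ∈ Finset.Icc 1 N, a n) atTop (nhds ⊤) := by
  have h1 := ENNReal.tendsto_nat_tsum a
  rw [ha] at h1
  refine ((tendsto_add_atTop_iff_nat 1).2 h1).congr fun N => ?_
  rw [Finset.sum_range_succ', h0, add_zero, Finset.sum_bij' (fun n _ => n + 1) (fun n _ => n - 1)]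
  · intro n hn
    rw [Finset.mem_range] at hn
    rw [Finset.mem_Icc]
    omega
  · intro n hn
    rw [Finset.mem_Icc] at hn
    rw [Finset.mem_range]
    omega
  · simp
  · intro n hn
    rw [Finset.mem_Icc] at hn
    omega
  · simp

/-- A functional form of the Kochen–Stone lemma. -/
theorem measure_frequently_ne_zero_pos {α : Type*} [MeasurableSpace α] (ν : Measure α)
    [IsFiniteMeasure ν] (f : ℕ → α → ENNReal) (hf : ∀ n, Measurable (f n)) (hf0 : f 0 = 0)
    (hfin : ∀ n, ∫⁻ x, f n x ∂ν ≠ ⊤) (hdiv : ∑' n, ∫⁻ x, f n x ∂ν = ⊤) {c : ENNReal} (hc : c ≠ 0)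
    (hfreq : ∃ᶠ N in atTop,
      c * ∑ m ∈ Finset.Icc 1 N, ∑ n ∈ Finset.Icc 1 N, ∫⁻ x, f m x * f n x ∂ν ≤
        (∑ n ∈ Finset.Icc 1 N, ∫⁻ x, f n x ∂ν) ^ 2) :
    0 < ν {x | ∃ᶠ n in atTop, f n x ≠ 0} := by
  set U : ℕ → Set α := fun M => {x | ∃ n > M, f n x ≠ 0} with hU
  have hUm : ∀ M, MeasurableSet (U M) := by
    intro M
    have : U M = ⋃ n > M, {x | f n x ≠ 0} := by
      ext x
      simp [hU]
    rw [this]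
    exact MeasurableSet.biUnion (Set.to_countable _) fun n _ =>
      (measurableSet_eq_fun (hf n) measurable_const).compl
  have hUanti : Antitone U := fun M M' h x ⟨n, hn, hx⟩ => ⟨n, lt_of_le_of_lt h hn, hx⟩
  have hinter : {x | ∃ᶠ n in atTop, f n x ≠ 0} = ⋂ M, U M := by
    ext x
    simp only [Set.mem_ofPred_eq, Set.mem_iInter, hU, frequently_atTop']
  set S : ℕ → ENNReal := fun N => ∑ n ∈ Finset.Icc 1 N, ∫⁻ x, f n x ∂ν with hS
  have hSfin : ∀ N, S N ≠ ⊤ := fun N => ENNReal.sum_ne_top.2 fun n _ => hfin n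
  have hSlim : Tendsto S atTop (nhds ⊤) :=
    tendsto_sum_Icc_one (by simp [hf0]) hdiv
  have hprod : ∀ m n, Measurable fun x => f m x * f n x := fun m n => (hf m).mul (hf n)
  have hlow : ∀ M, c ≤ 4 * ν (U M) := by
    intro M
    have hev : ∀ᶠ N in atTop, M ≤ N ∧ 2 * S M + 1 < S N :=
      (eventually_ge_atTop M).and (hSlim.eventually_const_lt
        (ENNReal.add_lt_top.2 ⟨ENNReal.mul_lt_top (by simp) (hSfin M).lt_top, by simp⟩))
    obtain ⟨N, hN, hMN, hgt⟩ := (hfreq.and_eventually hev).exists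
    set D := ∑ m ∈ Finset.Icc 1 N, ∑ n ∈ Finset.Icc 1 N, ∫⁻ x, f m x * f n x ∂ν with hD
    set F : α → ENNReal := fun x => ∑ n ∈ Finset.Ioc M N, f n x with hF
    have hFm : Measurable F := Finset.measurable_fun_sum _ fun n _ => hf n
    have hFU : ∀ x ∉ U M, F x = 0 := by
      intro x hx
      refine Finset.sum_eq_zero fun n hn => ?_
      by_contra h
      exact hx ⟨n, (Finset.mem_Ioc.1 hn).1, h⟩
    have hsubset : Finset.Ioc M N ⊆ Finset.Icc 1 N := by
      intro n hn
      rw [Finset.mem_Ioc] at hn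
      rw [Finset.mem_Icc]
      omega
    have hT : ∫⁻ x, F x ∂ν = ∑ n ∈ Finset.Ioc M N, ∫⁻ x, f n x ∂ν :=
      lintegral_finsetSum _ fun n _ => hf n
    have hsplit : S N = S M + ∫⁻ x, F x ∂ν := by
      rw [hT, hS]
      simp only
      rw [← Finset.sum_union]
      · congr 1
        ext n
        simp only [Finset.mem_union, Finset.mem_Icc, Finset.mem_Ioc]
        omega
      · rw [Finset.disjoint_left]
        intro n hn
        rw [Finset.mem_Icc] at hn
        rw [Finset.mem_Ioc]
        omega
    have hST : S N ≤ 2 * ∫⁻ x, F x ∂ν := by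
      refine (ENNReal.add_le_add_iff_left (hSfin N)).1 ?_
      calc S N + S N = 2 * S M + 2 * ∫⁻ x, F x ∂ν := by rw [hsplit]; ring
        _ ≤ S N + 2 * ∫⁻ x, F x ∂ν := by
          gcongr
          exact le_self_add.trans hgt.le
    have hFD : ∫⁻ x, F x * F x ∂ν ≤ D := by
      calc ∫⁻ x, F x * F x ∂ν
          = ∫⁻ x, ∑ m ∈ Finset.Ioc M N, ∑ n ∈ Finset.Ioc M N, f m x * f n x ∂ν := by
            refine lintegral_congr fun x => ?_
            rw [hF, Finset.sum_mul_sum]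
        _ = ∑ m ∈ Finset.Ioc M N, ∑ n ∈ Finset.Ioc M N, ∫⁻ x, f m x * f n x ∂ν := by
            rw [lintegral_finsetSum _ fun m _ =>
              Finset.measurable_fun_sum _ fun n _ => hprod m n]
            exact Finset.sum_congr rfl fun m _ => lintegral_finsetSum _ fun n _ => hprod m n
        _ ≤ D := (Finset.sum_le_sum fun m _ => Finset.sum_le_sum_of_subset hsubset).trans
            (Finset.sum_le_sum_of_subset hsubset)
    have hsq : S N ^ 2 ≤ D * (4 * ν (U M)) := by
      calc S N ^ 2 ≤ (2 * ∫⁻ x, F x ∂ν) ^ 2 := pow_le_pow_left₀ zero_le hST 2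
        _ = 4 * (∫⁻ x, F x ∂ν) ^ 2 := by ring
        _ ≤ 4 * ((∫⁻ x, F x * F x ∂ν) * ν (U M)) := by
            gcongr
            exact lintegral_sq_le ν hFm (hUm M) hFU
        _ ≤ 4 * (D * ν (U M)) := by gcongr
        _ = _ := by ring
    have hSpos : S N ^ 2 ≠ 0 := pow_ne_zero 2 (pos_of_gt hgt).ne'
    have hDtop : D ≠ ⊤ := by
      intro h
      rw [h, ENNReal.mul_top hc] at hN
      exact ENNReal.pow_ne_top (hSfin N) (top_le_iff.1 hN)
    have hD0 : D ≠ 0 := by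
      intro h
      rw [h, zero_mul] at hsq
      exact hSpos (le_antisymm hsq zero_le)
    refine (ENNReal.mul_le_mul_iff_left hD0 hDtop).1 ?_
    calc c * D ≤ S N ^ 2 := hN
      _ ≤ _ := hsq.trans (mul_comm _ _).le
  have hlim : Tendsto (ν ∘ U) atTop (nhds (ν (⋂ M, U M))) :=
    tendsto_measure_iInter_atTop (fun M => (hUm M).nullMeasurableSet) hUanti
      ⟨0, measure_ne_top ν _⟩
  have hc4 : c / 4 ≤ ν (⋂ M, U M) := ge_of_tendsto' hlim fun M =>
    ENNReal.div_le_of_le_mul' (hlow M)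
  rw [hinter]
  exact (ENNReal.div_pos hc (by simp)).trans_le hc4

/-- The number of points of additive order `n` at distance less than `ρ` from `x`. -/
def ballCount (n : ℕ) (ρ : ℝ) (x : UnitAddCircle) : ENNReal :=
  ∑ b ∈ orderPoints n, (Metric.ball b ρ).indicator 1 x

theorem measurable_ballCount (n : ℕ) (ρ : ℝ) : Measurable (ballCount n ρ) :=
  Finset.measurable_fun_sum _ fun _ _ => measurable_one.indicator Metric.isOpen_ball.measurableSet

theorem ballCount_zero_left (ρ : ℝ) : ballCount 0 ρ = 0 := by
  ext x
  simp [ballCount, orderPoints]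

theorem ballCount_of_nonpos (n : ℕ) {ρ : ℝ} (hρ : ρ ≤ 0) : ballCount n ρ = 0 := by
  ext x
  simp [ballCount, Metric.ball_eq_empty.2 hρ]

theorem ballCount_ne_zero_iff {n : ℕ} {ρ : ℝ} {x : UnitAddCircle} :
    ballCount n ρ x ≠ 0 ↔ ∃ b ∈ orderPoints n, ‖x - b‖ < ρ := by
  simp [ballCount, Finset.sum_eq_zero_iff, dist_eq_norm]

theorem volume_ball_unitAddCircle (b : UnitAddCircle) (ρ : ℝ) :
    volume (Metric.ball b ρ) = ENNReal.ofReal (min 1 (2 * ρ)) := by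
  rw [← measure_congr AddCircle.closedBall_ae_eq_ball, AddCircle.volume_closedBall]

theorem lintegral_ballCount (n : ℕ) {ρ : ℝ} (hρ : ρ ≤ 1 / 2) :
    ∫⁻ x, ballCount n ρ x = n.totient * ENNReal.ofReal (2 * ρ) := by
  simp only [ballCount]
  rw [lintegral_finsetSum _ fun b _ =>
    measurable_one.indicator Metric.isOpen_ball.measurableSet]
  simp only [lintegral_indicator_one Metric.isOpen_ball.measurableSet, volume_ball_unitAddCircle]
  rw [Finset.sum_const, card_orderPoints, nsmul_eq_mul, min_eq_right (by linarith)]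

theorem lintegral_ballCount_mul_le (m n : ℕ) (ρ σ : ℝ) :
    ∫⁻ x, ballCount m ρ x * ballCount n σ x ≤
      ((orderPoints m ×ˢ orderPoints n).filter fun q => ‖q.1 - q.2‖ < ρ + σ).card *
        ENNReal.ofReal (2 * min ρ σ) := by
  have hind : ∀ q : UnitAddCircle × UnitAddCircle, Measurable fun x =>
      (Metric.ball q.1 ρ ∩ Metric.ball q.2 σ).indicator (1 : UnitAddCircle → ENNReal) x :=
    fun q => measurable_one.indicator
      (Metric.isOpen_ball.inter Metric.isOpen_ball).measurableSet
  calc ∫⁻ x, ballCount m ρ x * ballCount n σ x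
      = ∫⁻ x, ∑ q ∈ orderPoints m ×ˢ orderPoints n,
          (Metric.ball q.1 ρ ∩ Metric.ball q.2 σ).indicator (1 : UnitAddCircle → ENNReal) x := by
        refine lintegral_congr fun x => ?_
        simp only [ballCount]
        rw [Finset.sum_mul_sum, ← Finset.sum_product']
        refine Finset.sum_congr rfl fun q _ => ?_
        rw [Set.inter_indicator_one]
        rfl
    _ = ∑ q ∈ orderPoints m ×ˢ orderPoints n,
          volume (Metric.ball q.1 ρ ∩ Metric.ball q.2 σ) := by
        rw [lintegral_finsetSum _ fun q _ => hind q]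
        refine Finset.sum_congr rfl fun q _ => ?_
        rw [lintegral_indicator_one (Metric.isOpen_ball.inter Metric.isOpen_ball).measurableSet]
    _ ≤ ∑ q ∈ orderPoints m ×ˢ orderPoints n,
          if ‖q.1 - q.2‖ < ρ + σ then ENNReal.ofReal (2 * min ρ σ) else 0 := by
        refine Finset.sum_le_sum fun q _ => ?_
        split_ifs with h
        · rw [mul_min_of_nonneg _ _ (by norm_num : (0 : ℝ) ≤ 2), ENNReal.ofReal_min]
          refine le_min ?_ ?_
          · refine (measure_mono Set.inter_subset_left).trans ?_
            rw [volume_ball_unitAddCircle]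
            exact ENNReal.ofReal_le_ofReal (min_le_right _ _)
          · refine (measure_mono Set.inter_subset_right).trans ?_
            rw [volume_ball_unitAddCircle]
            exact ENNReal.ofReal_le_ofReal (min_le_right _ _)
        · rw [(Metric.ball_disjoint_ball (by rw [dist_eq_norm]; linarith)).inter_eq, measure_empty]
    _ = _ := by rw [← Finset.sum_filter, Finset.sum_const, nsmul_eq_mul]

theorem lintegral_ballCount_mul_le_of_le {ψ : ℕ → ℝ} (hψ : ∀ n, ψ n ≤ 1 / 2) {m n : ℕ}
    (hm : Squarefree m) (hn : Squarefree n) (hmψ : 1 / 4 ≤ m * ψ m) (hnψ : 1 / 4 ≤ n * ψ n)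
    (hle : ψ m ≤ ψ n) :
    ∫⁻ x, ballCount m (ψ m) x * ballCount n (ψ n) x ≤
      ENNReal.ofReal (2 * (48 * (1 + 2 * (Real.log 4 + 4)))) *
        ((∫⁻ x, ballCount m (ψ m) x) * ∫⁻ x, ballCount n (ψ n) x) +
        if m = n then ∫⁻ x, ballCount n (ψ n) x else 0 := by
  classical
  have hlog4 : 0 ≤ Real.log 4 := Real.log_nonneg (by norm_num)
  set K : ℝ := 48 * (1 + 2 * (Real.log 4 + 4)) with hK
  have hm0 : (0 : ℝ) < m := by exact_mod_cast Nat.pos_of_ne_zero hm.ne_zero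
  have hn0 : (0 : ℝ) < n := by exact_mod_cast Nat.pos_of_ne_zero hn.ne_zero
  have hψm : 0 < ψ m := pos_of_mul_pos_right (by linarith) hm0.le
  have hψn : 0 < ψ n := pos_of_mul_pos_right (by linarith) hn0.le
  have hnear := card_near_pairs_le hm hn (R := 2 * ψ n) (by nlinarith) (by nlinarith)
  rw [← hK] at hnear
  have hcard : (((orderPoints m ×ˢ orderPoints n).filter fun q =>
      ‖q.1 - q.2‖ < ψ m + ψ n).card : ℝ) ≤
      2 * K * m.totient * n.totient * (2 * ψ n) + if m = n then (n.totient : ℝ) else 0 := by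
    have hsub : ((orderPoints m ×ˢ orderPoints n).filter fun q => ‖q.1 - q.2‖ < ψ m + ψ n) ⊆
        ((orderPoints m ×ˢ orderPoints n).filter fun q =>
          q.1 ≠ q.2 ∧ ‖q.1 - q.2‖ ≤ 2 * ψ n) ∪
        if m = n then (orderPoints n).image fun a => (a, a) else ∅ := by
      rintro ⟨a, b⟩ hab
      obtain ⟨h1, h2⟩ := Finset.mem_filter.1 hab
      by_cases hne : a = b
      · subst hne
        obtain ⟨ha, hb⟩ := Finset.mem_product.1 h1
        have hmn : m = n := (mem_orderPoints.1 ha).2.symm.trans (mem_orderPoints.1 hb).2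
        rw [if_pos hmn]
        exact Finset.mem_union_right _ (Finset.mem_image_of_mem _ hb)
      · exact Finset.mem_union_left _ (Finset.mem_filter.2 ⟨h1, hne, by linarith [h2]⟩)
    have h3 := (Finset.card_le_card hsub).trans (Finset.card_union_le _ _)
    refine (Nat.cast_le.2 h3).trans ?_
    rw [Nat.cast_add]
    refine add_le_add hnear ?_
    split_ifs
    · exact_mod_cast Finset.card_image_le.trans (card_orderPoints n).le
    · simp
  have hmul := lintegral_ballCount_mul_le m n (ψ m) (ψ n)
  rw [min_eq_left hle] at hmul
  refine hmul.trans ?_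
  rw [lintegral_ballCount m (hψ m), lintegral_ballCount n (hψ n)]
  have key : (((orderPoints m ×ˢ orderPoints n).filter fun q =>
      ‖q.1 - q.2‖ < ψ m + ψ n).card : ℝ) * (2 * ψ m) ≤
      2 * K * (m.totient * (2 * ψ m) * (n.totient * (2 * ψ n))) +
        if m = n then n.totient * (2 * ψ n) else 0 := by
    refine (mul_le_mul_of_nonneg_right hcard (by positivity)).trans ?_
    rw [add_mul]
    refine add_le_add (by ring_nf; exact le_rfl) ?_
    split_ifs
    · gcongr
    · simp
  have hnat : ∀ (k : ℕ) (r : ℝ), (k : ENNReal) * ENNReal.ofReal r = ENNReal.ofReal (k * r) :=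
    fun k r => by rw [ENNReal.ofReal_mul (Nat.cast_nonneg k), ENNReal.ofReal_natCast]
  simp only [hnat]
  rw [← ENNReal.ofReal_mul (by positivity), ← ENNReal.ofReal_mul (by positivity)]
  split_ifs at key ⊢
  · rw [← ENNReal.ofReal_add (by positivity) (by positivity)]
    exact ENNReal.ofReal_le_ofReal key
  · rw [add_zero] at key ⊢
    exact ENNReal.ofReal_le_ofReal key

theorem lintegral_ballCount_mul_le_add {ψ : ℕ → ℝ} (hψ' : ∀ n, ψ n ≤ 1 / 2)
    (hsq : ∀ n, ψ n ≠ 0 → Squarefree n ∧ 1 / 4 ≤ n * ψ n) (m n : ℕ) :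
    ∫⁻ x, ballCount m (ψ m) x * ballCount n (ψ n) x ≤
      ENNReal.ofReal (2 * (48 * (1 + 2 * (Real.log 4 + 4)))) *
        ((∫⁻ x, ballCount m (ψ m) x) * ∫⁻ x, ballCount n (ψ n) x) +
        if m = n then ∫⁻ x, ballCount n (ψ n) x else 0 := by
  by_cases hm : ψ m = 0
  · simp [ballCount_of_nonpos m hm.le]
  by_cases hn : ψ n = 0
  · simp [ballCount_of_nonpos n hn.le]
  rcases le_total (ψ m) (ψ n) with hle | hle
  · exact lintegral_ballCount_mul_le_of_le hψ' (hsq m hm).1 (hsq n hn).1 (hsq m hm).2 (hsq n hn).2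
      hle
  · have := lintegral_ballCount_mul_le_of_le hψ' (hsq n hn).1 (hsq m hm).1 (hsq n hn).2
      (hsq m hm).2 hle
    simp only [mul_comm (ballCount m (ψ m) _)]
    rw [mul_comm (∫⁻ x, ballCount m (ψ m) x)]
    refine this.trans (add_le_add le_rfl ?_)
    by_cases hmn : m = n
    · subst hmn
      rfl
    · rw [if_neg (Ne.symm hmn)]
      exact zero_le

theorem volume_frequently_ballCount_pos_of_overlap {ψ : ℕ → ℝ}
    (hψ' : ∀ n, ψ n ≤ 1 / 2) (hsq : ∀ n, ψ n ≠ 0 → Squarefree n ∧ 1 / 4 ≤ n * ψ n)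
    (hdiv : ∑' n, ∫⁻ x, ballCount n (ψ n) x = ⊤) :
    0 < volume {x | ∃ᶠ n in atTop, ballCount n (ψ n) x ≠ 0} := by
  have hlog4 : 0 ≤ Real.log 4 := Real.log_nonneg (by norm_num)
  set κ : ENNReal := ENNReal.ofReal (2 * (48 * (1 + 2 * (Real.log 4 + 4)))) with hκ
  set I : ℕ → ENNReal := fun n => ∫⁻ x, ballCount n (ψ n) x with hI
  have hI0 : I 0 = 0 := by
    change ∫⁻ x, ballCount 0 (ψ 0) x = 0
    rw [ballCount_zero_left]
    simp
  have hκtop : κ + 1 ≠ ⊤ := ENNReal.add_ne_top.2 ⟨ENNReal.ofReal_ne_top, ENNReal.one_ne_top⟩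
  refine measure_frequently_ne_zero_pos volume (fun n => ballCount n (ψ n))
    (fun n => measurable_ballCount _ _) (ballCount_zero_left _) (fun n => ?_) hdiv
    (c := (κ + 1)⁻¹) (ENNReal.inv_ne_zero.2 hκtop) ?_
  · rw [lintegral_ballCount n (hψ' n)]
    exact ENNReal.mul_ne_top (ENNReal.natCast_ne_top _) ENNReal.ofReal_ne_top
  · refine Eventually.frequently ?_
    filter_upwards [(tendsto_sum_Icc_one hI0 hdiv).eventually_const_lt ENNReal.one_lt_top]
      with N hN
    set S := ∑ n ∈ Finset.Icc 1 N, I n with hS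
    have hle : ∑ m ∈ Finset.Icc 1 N, ∑ n ∈ Finset.Icc 1 N,
        ∫⁻ x, ballCount m (ψ m) x * ballCount n (ψ n) x ≤ (κ + 1) * S ^ 2 := by
      calc _ ≤ ∑ m ∈ Finset.Icc 1 N, ∑ n ∈ Finset.Icc 1 N,
            (κ * (I m * I n) + if m = n then I n else 0) :=
            Finset.sum_le_sum fun m _ => Finset.sum_le_sum fun n _ =>
              lintegral_ballCount_mul_le_add hψ' hsq m n
        _ = κ * (S * S) + S := by
            simp only [Finset.sum_add_distrib, ← Finset.mul_sum]
            rw [← Finset.sum_mul]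
            congr 1
            refine Finset.sum_congr rfl fun m hm => ?_
            rw [Finset.sum_ite_eq, if_pos hm]
        _ ≤ κ * (S * S) + S * S := by
            gcongr
            exact le_mul_of_one_le_left zero_le hN.le
        _ = _ := by ring
    calc _ ≤ (κ + 1)⁻¹ * ((κ + 1) * S ^ 2) := by gcongr
      _ = S ^ 2 := by
        rw [← mul_assoc, ENNReal.inv_mul_cancel (by simp) hκtop, one_mul]
      _ ≤ _ := le_rfl

section Padic

variable {p : ℕ} [Fact p.Prime]

theorem PadicInt.toZModPow_preimage_singleton (k : ℕ) (y : ℤ_[p]) :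
    PadicInt.toZModPow k ⁻¹' {PadicInt.toZModPow k y} = {x | ‖x - y‖ ≤ (p : ℝ) ^ (-k : ℤ)} := by
  ext x
  rw [Set.mem_preimage, Set.mem_singleton_iff, ← sub_eq_zero, ← map_sub, ← RingHom.mem_ker,
    PadicInt.ker_toZModPow, ← PadicInt.norm_le_pow_iff_mem_span_pow]
  rfl

variable [MeasurableSpace ℤ_[p]] [BorelSpace ℤ_[p]] (μ : Measure ℤ_[p]) [μ.IsAddHaarMeasure]
  [IsProbabilityMeasure μ]

theorem PadicInt.measurableSet_norm_sub_le (y : ℤ_[p]) (r : ℝ) :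
    MeasurableSet {x : ℤ_[p] | ‖x - y‖ ≤ r} :=
  measurableSet_le ((continuous_id.sub continuous_const).norm.measurable) measurable_const

theorem PadicInt.measure_norm_sub_le (k : ℕ) (y : ℤ_[p]) :
    μ {x | ‖x - y‖ ≤ (p : ℝ) ^ (-k : ℤ)} = ((p : ENNReal) ^ k)⁻¹ := by
  have hp : p.Prime := Fact.out
  have : NeZero (p ^ k) := ⟨pow_ne_zero k hp.ne_zero⟩
  have hshift : ∀ y : ℤ_[p], μ {x | ‖x - y‖ ≤ (p : ℝ) ^ (-k : ℤ)} =
      μ {x | ‖x‖ ≤ (p : ℝ) ^ (-k : ℤ)} := by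
    intro y
    rw [← measure_preimage_add_right μ (-y) {x | ‖x‖ ≤ (p : ℝ) ^ (-k : ℤ)}]
    simp [sub_eq_add_neg]
  rw [hshift y]
  have hsurj := ZMod.ringHom_surjective (PadicInt.toZModPow (p := p) k)
  have hpre : ∀ z : ZMod (p ^ k), ∃ y, PadicInt.toZModPow k ⁻¹' {z} =
      {x : ℤ_[p] | ‖x - y‖ ≤ (p : ℝ) ^ (-k : ℤ)} := by
    intro z
    obtain ⟨y, rfl⟩ := hsurj z
    exact ⟨y, PadicInt.toZModPow_preimage_singleton k y⟩
  have hsum := sum_measure_preimage_singleton (μ := μ) (Finset.univ : Finset (ZMod (p ^ k)))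
    (f := PadicInt.toZModPow k) fun z _ => by
      obtain ⟨y, hy⟩ := hpre z
      rw [hy]
      exact PadicInt.measurableSet_norm_sub_le y _
  have hconst : ∀ z : ZMod (p ^ k), μ (PadicInt.toZModPow k ⁻¹' {z}) =
      μ {x | ‖x‖ ≤ (p : ℝ) ^ (-k : ℤ)} := by
    intro z
    obtain ⟨y, hy⟩ := hpre z
    rw [hy, hshift]
  simp only [hconst, Finset.sum_const, Finset.card_univ, ZMod.card, Finset.coe_univ,
    Set.preimage_univ, measure_univ, nsmul_eq_mul] at hsum
  rw [Nat.cast_pow] at hsum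
  exact ENNReal.eq_inv_of_mul_eq_one_left (by rw [mul_comm]; exact hsum)

theorem PadicInt.measure_toZModPow_preimage (k : ℕ) (Z : Finset (ZMod (p ^ k))) :
    μ (PadicInt.toZModPow k ⁻¹' (Z : Set (ZMod (p ^ k)))) = Z.card * ((p : ENNReal) ^ k)⁻¹ := by
  have hp : p.Prime := Fact.out
  have : NeZero (p ^ k) := ⟨pow_ne_zero k hp.ne_zero⟩
  have hsurj := ZMod.ringHom_surjective (PadicInt.toZModPow (p := p) k)
  have hpre : ∀ z : ZMod (p ^ k), ∃ y, PadicInt.toZModPow k ⁻¹' {z} =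
      {x : ℤ_[p] | ‖x - y‖ ≤ (p : ℝ) ^ (-k : ℤ)} := by
    intro z
    obtain ⟨y, rfl⟩ := hsurj z
    exact ⟨y, PadicInt.toZModPow_preimage_singleton k y⟩
  rw [← sum_measure_preimage_singleton Z (f := PadicInt.toZModPow k) fun z _ => by
      obtain ⟨y, hy⟩ := hpre z
      rw [hy]
      exact PadicInt.measurableSet_norm_sub_le y _]
  rw [Finset.sum_congr rfl fun z _ => by
    obtain ⟨y, hy⟩ := hpre z
    rw [hy, PadicInt.measure_norm_sub_le μ], Finset.sum_const, nsmul_eq_mul]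

theorem PadicInt.noAtoms : NullSingletonClass μ := by
  have hp : p.Prime := Fact.out
  refine ⟨fun x => ?_⟩
  have h1 : ∀ k : ℕ, μ {x} ≤ ((p : ENNReal)⁻¹) ^ k := by
    intro k
    rw [← ENNReal.inv_pow, ← PadicInt.measure_norm_sub_le μ k x]
    refine measure_mono ?_
    rintro _ rfl
    simp only [Set.mem_ofPred_eq, sub_self, norm_zero]
    positivity
  have h2 : Tendsto (fun k : ℕ => ((p : ENNReal)⁻¹) ^ k) atTop (nhds 0) :=
    ENNReal.tendsto_pow_atTop_nhds_zero_of_lt_one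
      (ENNReal.inv_lt_one.2 (by exact_mod_cast hp.one_lt))
  exact le_antisymm (ge_of_tendsto' h2 h1) zero_le

end Padic

theorem card_orderPoints_closedBall_le (n : ℕ) (c : UnitAddCircle) {r : ℝ} (hr : 0 ≤ r) :
    (((orderPoints n).filter fun b => ‖b - c‖ ≤ r).card : ℝ) ≤ 2 * n * r + 1 := by
  classical
  rcases n.eq_zero_or_pos with rfl | hn
  · simp [orderPoints]
  have hn0 : (0 : ℝ) < n := by exact_mod_cast hn
  obtain ⟨y, rfl⟩ := QuotientAddGroup.mk_surjective c
  have hsub : ((orderPoints n).filter fun b => ‖b - (y : UnitAddCircle)‖ ≤ r) ⊆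
      (Finset.Icc ⌈n * (y - r)⌉ ⌊n * (y + r)⌋).image
        fun a : ℤ => ((a / n : ℝ) : UnitAddCircle) := by
    intro b hb
    obtain ⟨h1, h2⟩ := Finset.mem_filter.1 hb
    obtain ⟨a, -, -, rfl⟩ := mem_orderPoints_iff_exists.1 h1
    rw [← AddCircle.coe_sub, UnitAddCircle.norm_eq, abs_le] at h2
    set j := round ((a / n : ℝ) - y)
    refine Finset.mem_image.2 ⟨a - n * j, Finset.mem_Icc.2 ⟨?_, ?_⟩, ?_⟩
    · rw [Int.ceil_le]
      push_cast
      have h3 : y - r ≤ a / n - j := by linarith [h2.1]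
      calc n * (y - r) ≤ n * (a / n - j : ℝ) := mul_le_mul_of_nonneg_left h3 hn0.le
        _ = _ := by field_simp
    · rw [Int.le_floor]
      push_cast
      have h3 : a / n - j ≤ y + r := by linarith [h2.2]
      calc (a - n * j : ℝ) = n * (a / n - j : ℝ) := by field_simp
        _ ≤ _ := mul_le_mul_of_nonneg_left h3 hn0.le
    · rw [← sub_eq_zero, ← AddCircle.coe_sub, AddCircle.coe_eq_zero_iff]
      refine ⟨-j, ?_⟩
      push_cast
      simp only [zsmul_eq_mul, mul_one, Int.cast_neg]
      field_simp
      ring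
  have hcard := (Finset.card_le_card hsub).trans Finset.card_image_le
  rw [Int.card_Icc] at hcard
  have h5 : ((⌊n * (y + r)⌋ + 1 - ⌈n * (y - r)⌉).toNat : ℝ) ≤ 2 * n * r + 1 := by
    have h6 : (((⌊n * (y + r)⌋ + 1 - ⌈n * (y - r)⌉).toNat : ℤ) : ℝ) ≤ 2 * n * r + 1 := by
      rw [Int.toNat_eq_max]
      push_cast
      refine max_le ?_ (by positivity)
      have h7 := Int.floor_le (n * (y + r) : ℝ)
      have h8 := Int.le_ceil (n * (y - r) : ℝ)
      linarith
    exact_mod_cast h6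
  exact (Nat.cast_le.2 hcard).trans h5

section PadicE

variable {p : ℕ} [Fact p.Prime]

theorem mem_padicE_of_norm_sub_le {n k : ℕ} (hpn : p.Coprime n) {b : UnitAddCircle}
    (hb : b ∈ orderPoints n) {t : ℤ}
    (ht : ‖((-t / p ^ k : ℝ) : UnitAddCircle) - b‖ ≤ ((p : ℝ) ^ k)⁻¹) {x : ℤ_[p]}
    (hx : ‖x - t‖ ≤ ((p : ℝ) ^ k)⁻¹) {ψ : ℕ → ℝ} (hψ : ((p : ℝ) ^ k)⁻¹ ≤ ψ n) :
    x ∈ padicE p ψ n := by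
  have hp : p.Prime := Fact.out
  have hp0 : (0 : ℝ) < p := by exact_mod_cast hp.pos
  obtain ⟨c, hcn, hc, rfl⟩ := mem_orderPoints_iff_exists.1 hb
  have hn : 0 < n := by omega
  have hn0 : (0 : ℝ) < n := by exact_mod_cast hn
  have hnorm : ‖(n : ℚ_[p])‖ = 1 := Padic.norm_natCast_eq_one_iff.2 hpn
  have hnne : (n : ℚ_[p]) ≠ 0 := by exact_mod_cast hn.ne'
  rw [← AddCircle.coe_sub, UnitAddCircle.norm_eq] at ht
  set r := round ((-t / p ^ k : ℝ) - c / n)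
  refine ⟨p ^ k * (c + n * r) + n * t, ?_, ?_, ?_⟩
  · have h1 : ((p ^ k * (c + n * r) + n * t : ℤ) : ℝ) =
        -(n * p ^ k) * ((-t / p ^ k : ℝ) - c / n - r) := by
      push_cast
      field_simp
      ring
    have h2 : |((p ^ k * (c + n * r) + n * t : ℤ) : ℝ)| ≤ n := by
      rw [h1, abs_mul, abs_neg, abs_of_pos (by positivity)]
      calc (n * p ^ k : ℝ) * _ ≤ n * p ^ k * ((p : ℝ) ^ k)⁻¹ :=
            mul_le_mul_of_nonneg_left ht (by positivity)
        _ = n := by field_simp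
    exact_mod_cast h2
  · rw [← Int.isCoprime_iff_gcd_eq_one]
    have h1 : IsCoprime (c : ℤ) n := Nat.isCoprime_iff_coprime.2 hc
    have h2 : IsCoprime ((p : ℤ) ^ k) n := (Nat.isCoprime_iff_coprime.2 hpn).pow_left
    exact (h2.mul_left (h1.add_mul_left_left r)).add_mul_left_left t
  · refine le_trans ?_ hψ
    have h1 : (x : ℚ_[p]) - ((p ^ k * (c + n * r) + n * t : ℤ) : ℚ_[p]) / n =
        ((x - t : ℤ_[p]) : ℚ_[p]) - (p ^ k : ℕ) * ((c + n * r : ℤ) / n) := by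
      push_cast
      field_simp
      ring
    rw [h1, sub_eq_add_neg]
    refine (Padic.nonarchimedean _ _).trans (max_le hx ?_)
    rw [norm_neg, norm_mul, norm_div, hnorm, div_one]
    calc _ ≤ ‖((p ^ k : ℕ) : ℚ_[p])‖ * 1 :=
          mul_le_mul_of_nonneg_left (Padic.norm_int_le_one _) (norm_nonneg _)
      _ = _ := by simp

theorem exists_nsmul_eq_norm_sub_le {n : ℕ} (hpn : p.Coprime n) (i k : ℕ) {b : UnitAddCircle}
    (hb : b ∈ orderPoints n) :
    ∃ s ∈ orderPoints n, ∃ t : ℤ, p ^ i • s = b ∧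
      ‖((-t / p ^ k : ℝ) : UnitAddCircle) - s‖ ≤ ((p : ℝ) ^ k)⁻¹ / 2 := by
  have hp : p.Prime := Fact.out
  have hp0 : (0 : ℝ) < p := by exact_mod_cast hp.pos
  obtain ⟨hn, hbn⟩ := mem_orderPoints.1 hb
  have hcop : (p ^ i).Coprime n := Nat.Coprime.pow_left i hpn
  obtain ⟨q, hq⟩ : ∃ q : ℕ, p ^ i * q ≡ 1 [MOD n] := by
    obtain ⟨q, hq⟩ := Nat.exists_mul_mod_eq_of_coprime 1 hcop hn.ne'
    exact ⟨q, hq.2⟩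
  have hqn : n.Coprime q := by
    have h1 : (p ^ i * q).Coprime n := by
      rw [Nat.Coprime, hq.gcd_eq]
      simp
    exact (Nat.Coprime.coprime_mul_left h1).symm
  have hs : q • b ∈ orderPoints n := by
    rw [mem_orderPoints]
    refine ⟨hn, ?_⟩
    rw [Nat.Coprime.addOrderOf_nsmul (by rwa [hbn]), hbn]
  refine ⟨q • b, hs, ?_⟩
  obtain ⟨c, -, -, hc⟩ := mem_orderPoints_iff_exists.1 hs
  refine ⟨-round (p ^ k * (c / n) : ℝ), ?_, ?_⟩
  · rw [← mul_smul]
    conv_rhs => rw [← one_nsmul b]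
    rw [nsmul_eq_nsmul_iff_modEq, hbn]
    exact hq
  · rw [← hc, ← AddCircle.coe_sub]
    set y : ℝ := p ^ k * (c / n) with hy
    refine (QuotientAddGroup.norm_mk_le_norm).trans ?_
    have h1 : (-((-round y : ℤ) : ℝ) / p ^ k - c / n : ℝ) = -(y - round y) * ((p : ℝ) ^ k)⁻¹ := by
      push_cast
      rw [hy]
      field_simp
      ring
    rw [h1, Real.norm_eq_abs, abs_mul, abs_neg, abs_of_pos (by positivity : 0 < ((p : ℝ) ^ k)⁻¹)]
    have h2 := abs_sub_round y
    calc _ ≤ 1 / 2 * ((p : ℝ) ^ k)⁻¹ := mul_le_mul_of_nonneg_right h2 (by positivity)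
      _ = _ := by ring

theorem coe_neg_div_eq_of_zmod_eq {k : ℕ} {s t : ℤ} (h : (s : ZMod (p ^ k)) = t) :
    ((-s / p ^ k : ℝ) : UnitAddCircle) = ((-t / p ^ k : ℝ) : UnitAddCircle) := by
  have hp : p.Prime := Fact.out
  have hp0 : (0 : ℝ) < p := by exact_mod_cast hp.pos
  obtain ⟨c, hc⟩ := (ZMod.intCast_eq_intCast_iff_dvd_sub _ _ _).1 h
  rw [← sub_eq_zero, ← AddCircle.coe_sub, AddCircle.coe_eq_zero_iff]
  refine ⟨c, ?_⟩
  have h1 : (t : ℝ) - s = p ^ k * c := by exact_mod_cast hc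
  simp only [zsmul_eq_mul, mul_one]
  field_simp
  linarith

end PadicE

section PadicE

variable {p : ℕ} [Fact p.Prime] [MeasurableSpace ℤ_[p]] [BorelSpace ℤ_[p]]
  (μ : Measure ℤ_[p]) [μ.IsAddHaarMeasure] [IsProbabilityMeasure μ]

open Classical in
theorem card_orderPoints_near_mul_le {m n j k : ℕ} (hpm : p.Coprime m) (hpn : p.Coprime n)
    (hjk : j ≤ k) (hn : n < p ^ (k + 1)) {ψ : ℕ → ℝ} (hψm : ((p : ℝ) ^ j)⁻¹ ≤ ψ m)
    (hψn : ((p : ℝ) ^ k)⁻¹ ≤ ψ n) :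
    (((orderPoints n).filter fun b => ∃ a ∈ orderPoints m, ‖a - b‖ ≤ ((p : ℝ) ^ j)⁻¹ / 2).card :
      ENNReal) * ((p : ENNReal) ^ k)⁻¹ ≤ (p + 1) * μ (padicE p ψ m ∩ padicE p ψ n) := by
  have hp : p.Prime := Fact.out
  have hp0 : (0 : ℝ) < p := by exact_mod_cast hp.pos
  set B := (orderPoints n).filter fun b => ∃ a ∈ orderPoints m, ‖a - b‖ ≤ ((p : ℝ) ^ j)⁻¹ / 2
    with hB
  have hex : ∀ b : UnitAddCircle, ∃ (s : UnitAddCircle) (t : ℤ), b ∈ orderPoints n →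
      s ∈ orderPoints n ∧ p ^ (k - j) • s = b ∧
      ‖((-t / p ^ k : ℝ) : UnitAddCircle) - s‖ ≤ ((p : ℝ) ^ k)⁻¹ / 2 := by
    intro b
    by_cases hb : b ∈ orderPoints n
    · obtain ⟨s, hs, t, h⟩ := exists_nsmul_eq_norm_sub_le hpn (k - j) k hb
      exact ⟨s, t, fun _ => ⟨hs, h⟩⟩
    · exact ⟨0, 0, fun h => absurd h hb⟩
  choose s t hst using hex
  set Z := B.image fun b => (t b : ZMod (p ^ k)) with hZ
  have hsub : PadicInt.toZModPow k ⁻¹' (Z : Set (ZMod (p ^ k))) ⊆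
      padicE p ψ m ∩ padicE p ψ n := by
    intro x hx
    obtain ⟨b, hb, hbx⟩ := Finset.mem_image.1 (Finset.mem_coe.1 hx)
    obtain ⟨hbn, a, ham, hab⟩ := Finset.mem_filter.1 hb
    obtain ⟨hs1, hs2, hs3⟩ := hst b hbn
    have hxt : ‖x - t b‖ ≤ ((p : ℝ) ^ k)⁻¹ := by
      have h1 : x ∈ PadicInt.toZModPow k ⁻¹' {PadicInt.toZModPow k (t b : ℤ_[p])} := by
        simp [← hbx]
      rw [PadicInt.toZModPow_preimage_singleton] at h1
      simpa using h1
    have hpj : ((p : ℝ) ^ k)⁻¹ ≤ ((p : ℝ) ^ j)⁻¹ := by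
      gcongr
      exact_mod_cast hp.one_lt.le
    refine ⟨mem_padicE_of_norm_sub_le hpm ham (t := t b) ?_ (hxt.trans hpj) hψm,
      mem_padicE_of_norm_sub_le hpn hs1 (hs3.trans (half_le_self (by positivity))) hxt hψn⟩
    have h2 : ((-t b / p ^ j : ℝ) : UnitAddCircle) - a =
        p ^ (k - j) • (((-t b / p ^ k : ℝ) : UnitAddCircle) - s b) - (a - b) := by
      rw [nsmul_sub, hs2, ← AddCircle.coe_nsmul]
      have h3 : (-t b / p ^ j : ℝ) = p ^ (k - j) • (-t b / p ^ k : ℝ) := by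
        have h4 : (p : ℝ) ^ k = p ^ (k - j) * p ^ j := by rw [← pow_add]; congr 1; omega
        rw [h4]
        simp only [nsmul_eq_mul]
        push_cast
        field_simp
      rw [← h3]
      abel
    rw [h2]
    refine (norm_sub_le _ _).trans ?_
    have h5 : ‖p ^ (k - j) • (((-t b / p ^ k : ℝ) : UnitAddCircle) - s b)‖ ≤
        ((p : ℝ) ^ j)⁻¹ / 2 := by
      refine (norm_nsmul_le).trans ?_
      push_cast
      have h4 : (p : ℝ) ^ k = p ^ (k - j) * p ^ j := by rw [← pow_add]; congr 1; omega
      calc (p : ℝ) ^ (k - j) * _ ≤ (p : ℝ) ^ (k - j) * (((p : ℝ) ^ k)⁻¹ / 2) := by gcongr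
        _ = _ := by rw [h4]; field_simp
    linarith
  have hcard : B.card ≤ (p + 1) * Z.card := by
    refine Finset.card_le_mul_card_image B (p + 1) ?_
    intro z hz
    obtain ⟨b, hb, rfl⟩ := Finset.mem_image.1 hz
    have h1 : (B.filter fun b' => (t b' : ZMod (p ^ k)) = t b).card ≤
        ((orderPoints n).filter fun c => ‖c - ((-t b / p ^ k : ℝ) : UnitAddCircle)‖ ≤
          ((p : ℝ) ^ k)⁻¹ / 2).card := by
      refine Finset.card_le_card_of_injOn s ?_ ?_
      · intro b' hb'
        obtain ⟨h1, h2⟩ := Finset.mem_filter.1 (Finset.mem_coe.1 hb')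
        obtain ⟨hs1, hs2, hs3⟩ := hst b' (Finset.mem_filter.1 h1).1
        refine Finset.mem_coe.2 (Finset.mem_filter.2 ⟨hs1, ?_⟩)
        rw [norm_sub_rev, ← coe_neg_div_eq_of_zmod_eq h2]
        exact hs3
      · intro b₁ hb₁ b₂ hb₂ h
        have h1 := (hst b₁ (Finset.mem_filter.1 (Finset.mem_filter.1 hb₁).1).1).2.1
        have h2 := (hst b₂ (Finset.mem_filter.1 (Finset.mem_filter.1 hb₂).1).1).2.1
        rw [← h1, ← h2, h]
    refine h1.trans ?_
    have h2 := card_orderPoints_closedBall_le n ((-t b / p ^ k : ℝ) : UnitAddCircle)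
      (r := ((p : ℝ) ^ k)⁻¹ / 2) (by positivity)
    have h3 : 2 * n * (((p : ℝ) ^ k)⁻¹ / 2) ≤ p := by
      have h4 : (n : ℝ) ≤ p ^ (k + 1) := by exact_mod_cast hn.le
      calc 2 * n * (((p : ℝ) ^ k)⁻¹ / 2) ≤ 2 * p ^ (k + 1) * (((p : ℝ) ^ k)⁻¹ / 2) := by gcongr
        _ = p := by rw [pow_succ]; field_simp
    have h5 : (((orderPoints n).filter fun c => ‖c - ((-t b / p ^ k : ℝ) : UnitAddCircle)‖ ≤
          ((p : ℝ) ^ k)⁻¹ / 2).card : ℝ) ≤ (p + 1 : ℕ) := by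
      push_cast
      linarith
    exact_mod_cast h5
  calc (B.card : ENNReal) * ((p : ENNReal) ^ k)⁻¹
      ≤ ((p + 1) * Z.card : ℕ) * ((p : ENNReal) ^ k)⁻¹ := by gcongr
    _ = (p + 1) * μ (PadicInt.toZModPow k ⁻¹' (Z : Set (ZMod (p ^ k)))) := by
      rw [PadicInt.measure_toZModPow_preimage μ]
      push_cast
      ring
    _ ≤ _ := by gcongr

theorem lintegral_ballCount_mul_le_measure_inter {m n j k : ℕ} (hpm : p.Coprime m)
    (hpn : p.Coprime n) (hjk : j ≤ k) (hm : m < p ^ (j + 1)) (hn : n < p ^ (k + 1)) {ρ σ : ℝ}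
    (hρ : 4 * ρ ≤ ((p : ℝ) ^ j)⁻¹) (hσ : 4 * σ ≤ ((p : ℝ) ^ k)⁻¹) {ψ : ℕ → ℝ}
    (hψm : ((p : ℝ) ^ j)⁻¹ ≤ ψ m) (hψn : ((p : ℝ) ^ k)⁻¹ ≤ ψ n) :
    ∫⁻ x, ballCount m ρ x * ballCount n σ x ≤
      (p + 1) ^ 2 * μ (padicE p ψ m ∩ padicE p ψ n) := by
  classical
  have hp : p.Prime := Fact.out
  have hp0 : (0 : ℝ) < p := by exact_mod_cast hp.pos
  have hpj : ((p : ℝ) ^ k)⁻¹ ≤ ((p : ℝ) ^ j)⁻¹ := by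
    gcongr
    exact_mod_cast hp.one_lt.le
  set P := (orderPoints m ×ˢ orderPoints n).filter fun q => ‖q.1 - q.2‖ < ρ + σ with hP
  set B := (orderPoints n).filter fun b => ∃ a ∈ orderPoints m, ‖a - b‖ ≤ ((p : ℝ) ^ j)⁻¹ / 2
    with hB
  have hcard : P.card ≤ (p + 1) * B.card := by
    refine Finset.card_le_mul_card_image_of_maps_to (f := Prod.snd) ?_ (p + 1) ?_
    · intro q hq
      obtain ⟨h1, h2⟩ := Finset.mem_filter.1 hq
      rw [Finset.mem_product] at h1
      exact Finset.mem_filter.2 ⟨h1.2, q.1, h1.1, by linarith⟩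
    · intro b hb
      have h1 : (P.filter fun q => q.2 = b).card ≤
          ((orderPoints m).filter fun c => ‖c - b‖ ≤ ((p : ℝ) ^ j)⁻¹ / 2).card := by
        refine Finset.card_le_card_of_injOn Prod.fst ?_ ?_
        · intro q hq
          obtain ⟨h1, h2⟩ := Finset.mem_filter.1 (Finset.mem_coe.1 hq)
          obtain ⟨h3, h4⟩ := Finset.mem_filter.1 h1
          refine Finset.mem_coe.2 (Finset.mem_filter.2 ⟨(Finset.mem_product.1 h3).1, ?_⟩)
          rw [← h2]
          linarith
        · intro q₁ h₁ q₂ h₂ h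
          exact Prod.ext h
            ((Finset.mem_filter.1 h₁).2.trans (Finset.mem_filter.1 h₂).2.symm)
      refine h1.trans ?_
      have h2 := card_orderPoints_closedBall_le m b (r := ((p : ℝ) ^ j)⁻¹ / 2) (by positivity)
      have h3 : 2 * m * (((p : ℝ) ^ j)⁻¹ / 2) ≤ p := by
        have h4 : (m : ℝ) ≤ p ^ (j + 1) := by exact_mod_cast hm.le
        calc 2 * m * (((p : ℝ) ^ j)⁻¹ / 2) ≤ 2 * p ^ (j + 1) * (((p : ℝ) ^ j)⁻¹ / 2) := by
              gcongr
          _ = p := by rw [pow_succ]; field_simp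
      have h5 : (((orderPoints m).filter fun c => ‖c - b‖ ≤ ((p : ℝ) ^ j)⁻¹ / 2).card : ℝ) ≤
          (p + 1 : ℕ) := by
        push_cast
        linarith
      exact_mod_cast h5
  have hmin : ENNReal.ofReal (2 * min ρ σ) ≤ ((p : ENNReal) ^ k)⁻¹ := by
    have h1 : ((p : ENNReal) ^ k)⁻¹ = ENNReal.ofReal (((p : ℝ) ^ k)⁻¹) := by
      rw [ENNReal.ofReal_inv_of_pos (by positivity), ENNReal.ofReal_pow hp0.le,
        ENNReal.ofReal_natCast]
    rw [h1]
    refine ENNReal.ofReal_le_ofReal ?_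
    have h2 := min_le_right ρ σ
    have h3 : 0 < ((p : ℝ) ^ k)⁻¹ := by positivity
    linarith
  calc _ ≤ (P.card : ENNReal) * ENNReal.ofReal (2 * min ρ σ) := lintegral_ballCount_mul_le m n ρ σ
    _ ≤ ((p + 1) * B.card : ℕ) * ((p : ENNReal) ^ k)⁻¹ := by gcongr
    _ = (p + 1) * (B.card * ((p : ENNReal) ^ k)⁻¹) := by
      push_cast
      ring
    _ ≤ (p + 1) * ((p + 1) * μ (padicE p ψ m ∩ padicE p ψ n)) :=
      mul_le_mul_right (card_orderPoints_near_mul_le μ hpm hpn hjk hn hψm hψn) _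
    _ = _ := by ring

theorem lintegral_ballCount_le_measure {n k : ℕ} (hpn : p.Coprime n) (hn : n < p ^ (k + 1))
    {σ : ℝ} (hσ : 4 * σ ≤ ((p : ℝ) ^ k)⁻¹) {ψ : ℕ → ℝ} (hψn : ((p : ℝ) ^ k)⁻¹ ≤ ψ n) :
    ∫⁻ x, ballCount n σ x ≤ (p + 1) * μ (padicE p ψ n) := by
  classical
  have hp : p.Prime := Fact.out
  have hp0 : (0 : ℝ) < p := by exact_mod_cast hp.pos
  have hp1 : (1 : ℝ) ≤ (p : ℝ) ^ k := one_le_pow₀ (by exact_mod_cast hp.one_lt.le)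
  have h0 := inv_le_one_of_one_le₀ hp1
  have h1 := card_orderPoints_near_mul_le μ hpn hpn le_rfl hn hψn hψn
  rw [Set.inter_self] at h1
  refine le_trans ?_ h1
  rw [lintegral_ballCount n (by linarith), ← card_orderPoints]
  refine mul_le_mul' (Nat.cast_le.2 (Finset.card_le_card fun b hb => ?_)) ?_
  · refine Finset.mem_filter.2 ⟨hb, b, hb, ?_⟩
    simp only [sub_self, norm_zero]
    positivity
  · have h1 : ((p : ENNReal) ^ k)⁻¹ = ENNReal.ofReal (((p : ℝ) ^ k)⁻¹) := by
      rw [ENNReal.ofReal_inv_of_pos (by positivity), ENNReal.ofReal_pow hp0.le,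
        ENNReal.ofReal_natCast]
    rw [h1]
    refine ENNReal.ofReal_le_ofReal ?_
    have h3 : 0 < ((p : ℝ) ^ k)⁻¹ := by positivity
    linarith

/-- The integers `a` with `|a| ≤ n` coprime to `n` are covered by three residue systems. -/
theorem card_Icc_neg_coprime_le (n : ℕ) (hn : 0 < n) :
    ((Finset.Icc (-n : ℤ) n).filter fun a => Int.gcd a n = 1).card ≤ 3 * n.totient := by
  have hn0 : (n : ℤ) ≠ 0 := by exact_mod_cast hn.ne'
  rw [Nat.totient_eq_card_coprime, mul_comm, mul_comm]
  refine Finset.card_le_mul_card_image_of_maps_to (f := fun a : ℤ => (a % n).toNat) ?_ 3 ?_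
  · intro a ha
    obtain ⟨h1, h2⟩ := Finset.mem_filter.1 ha
    have h3 := Int.emod_nonneg a hn0
    have h4 := Int.emod_lt_of_pos a (by exact_mod_cast hn : (0 : ℤ) < n)
    refine Finset.mem_filter.2 ⟨Finset.mem_range.2 (by omega), ?_⟩
    rw [Nat.coprime_comm, ← Nat.isCoprime_iff_coprime, Int.toNat_of_nonneg h3]
    rw [Int.isCoprime_iff_gcd_eq_one, Int.gcd_emod]
    exact h2
  · intro c hc
    have hc' := Finset.mem_range.1 (Finset.mem_filter.1 hc).1
    refine (Finset.card_le_card (t := {(c : ℤ), (c : ℤ) - n, (c : ℤ) + n}) ?_).trans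
      Finset.card_le_three
    intro a ha
    obtain ⟨h1, h2⟩ := Finset.mem_filter.1 ha
    obtain ⟨h3, h4⟩ := Finset.mem_Icc.1 (Finset.mem_filter.1 h1).1
    have h5 := Int.emod_nonneg a hn0
    have h6 := Int.emod_add_mul_ediv a n
    have h7 : a % n = c := by omega
    rw [h7] at h6
    have hn1 : (0 : ℤ) < n := by exact_mod_cast hn
    have h8 : a / n < 2 := by
      by_contra! h
      nlinarith
    have h9 : -2 < a / n := by
      by_contra! h
      nlinarith
    simp only [Finset.mem_insert, Finset.mem_singleton]
    obtain h | h | h : a / n = 0 ∨ a / n = -1 ∨ a / n = 1 := by omega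
    all_goals
      rw [h] at h6
      omega

theorem measure_padicE_le {n k : ℕ} (hpn : p.Coprime n) (hn : 0 < n) {ψ : ℕ → ℝ}
    (hψ : ψ n ≤ ((p : ℝ) ^ k)⁻¹) :
    μ (padicE p ψ n) ≤ 3 * n.totient * ((p : ENNReal) ^ k)⁻¹ := by
  have hnorm : ‖(n : ℚ_[p])‖ = 1 := Padic.norm_natCast_eq_one_iff.2 hpn
  have hle : ∀ a : ℤ, ∃ y : ℤ_[p], (y : ℚ_[p]) = a / n := by
    intro a
    refine ⟨⟨(a : ℚ_[p]) / n, ?_⟩, rfl⟩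
    rw [norm_div, hnorm, div_one]
    exact Padic.norm_int_le_one a
  choose y hy using hle
  have hsub : padicE p ψ n ⊆ ⋃ a ∈ (Finset.Icc (-n : ℤ) n).filter fun a => Int.gcd a n = 1,
      {x : ℤ_[p] | ‖x - y a‖ ≤ (p : ℝ) ^ (-k : ℤ)} := by
    rintro x ⟨a, ha, hgcd, hx⟩
    refine Set.mem_biUnion (Finset.mem_coe.2 (Finset.mem_filter.2
      ⟨Finset.mem_Icc.2 (abs_le.1 ha), hgcd⟩)) ?_
    rw [Set.mem_ofPred_eq, zpow_neg, zpow_natCast]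
    rw [← hy] at hx
    exact hx.trans hψ
  calc μ (padicE p ψ n) ≤ _ := measure_mono hsub
    _ ≤ _ := measure_biUnion_finset_le _ _
    _ = ((Finset.Icc (-n : ℤ) n).filter fun a => Int.gcd a n = 1).card *
        ((p : ENNReal) ^ k)⁻¹ := by
      simp only [PadicInt.measure_norm_sub_le μ, Finset.sum_const, nsmul_eq_mul]
    _ ≤ (3 * n.totient : ℕ) * ((p : ENNReal) ^ k)⁻¹ := by
      gcongr
      exact card_Icc_neg_coprime_le n hn
    _ = _ := by push_cast; ring

theorem measure_padicE_eq_zero {n : ℕ} {ψ : ℕ → ℝ} (hψ : ψ n = 0) : μ (padicE p ψ n) = 0 := by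
  have := PadicInt.noAtoms μ
  refine Set.Finite.measure_zero ?_ μ
  refine Set.Finite.of_finite_image (f := ((↑) : ℤ_[p] → ℚ_[p])) ?_
    (Subtype.coe_injective.injOn)
  refine ((Set.finite_Icc (-n : ℤ) n).image fun a : ℤ => (a : ℚ_[p]) / n).subset ?_
  rintro _ ⟨x, ⟨a, ha, -, hx⟩, rfl⟩
  refine ⟨a, abs_le.1 ha, ?_⟩
  rw [hψ] at hx
  exact (sub_eq_zero.1 (norm_le_zero_iff.1 hx)).symm

end PadicE

/-- Multiplication by `p` carries the points of exact order `p * m` onto those of order `m`. -/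
theorem ballCount_mul_le {p : ℕ} (hp : 0 < p) (m : ℕ) (ρ : ℝ) (x : UnitAddCircle) :
    ballCount (p * m) ρ x ≤ p * ballCount m (p * ρ) (p • x) := by
  classical
  have hp0 : (0 : ℝ) < p := by exact_mod_cast hp
  have hmaps : ∀ b ∈ orderPoints (p * m), p • b ∈ orderPoints m := by
    intro b hb
    rw [mem_orderPoints] at hb ⊢
    refine ⟨Nat.pos_of_mul_pos_left hb.1, ?_⟩
    rw [addOrderOf_nsmul_of_dvd hp.ne' (by rw [hb.2]; exact dvd_mul_right p m), hb.2]
    exact Nat.mul_div_cancel_left m hp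
  have hfib : ∀ c ∈ orderPoints m, ((orderPoints (p * m)).filter fun b => p • b = c).card ≤ p := by
    intro c hc
    rcases ((orderPoints (p * m)).filter fun b => p • b = c).eq_empty_or_nonempty with h | ⟨b₀, h⟩
    · simp [h]
    have hb₀ := (Finset.mem_filter.1 h).2
    have htor := AddCircle.card_torsion_le_of_isSMulRegular (1 : ℝ) p hp.ne'
      (fun x y h => by simpa [hp.ne'] using h)
    have h1 : (((orderPoints (p * m)).filter fun b => p • b = c : Finset UnitAddCircle) :
        Set UnitAddCircle).encard ≤ {x : UnitAddCircle | p • x = 0}.encard := by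
      refine Set.encard_le_encard_of_injOn (f := fun b => b - b₀) ?_ ?_
      · intro b hb
        have := (Finset.mem_filter.1 (Finset.mem_coe.1 hb)).2
        rw [Set.mem_ofPred_eq, nsmul_sub, this, hb₀, sub_self]
      · exact fun a _ b _ h => sub_left_injective h
    rw [Set.encard_coe_eq_coe_finsetCard] at h1
    exact_mod_cast h1.trans htor
  simp only [ballCount]
  rw [Finset.mul_sum, ← Finset.sum_fiberwise_of_maps_to hmaps]
  refine Finset.sum_le_sum fun c hc => ?_
  calc ∑ b ∈ (orderPoints (p * m)).filter (fun b => p • b = c),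
        (Metric.ball b ρ).indicator (1 : UnitAddCircle → ENNReal) x
      ≤ ∑ b ∈ (orderPoints (p * m)).filter (fun b => p • b = c),
        (Metric.ball c (p * ρ)).indicator (1 : UnitAddCircle → ENNReal) (p • x) := by
        refine Finset.sum_le_sum fun b hb => ?_
        rw [← (Finset.mem_filter.1 hb).2]
        by_cases h : x ∈ Metric.ball b ρ
        · rw [Set.indicator_of_mem h, Set.indicator_of_mem]
          · rfl
          · rw [mem_ball_iff_norm, ← nsmul_sub]
            rw [mem_ball_iff_norm] at h
            exact norm_nsmul_le.trans_lt (mul_lt_mul_of_pos_left h hp0)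
        · rw [Set.indicator_of_notMem h]
          exact zero_le
    _ ≤ _ := by
      rw [Finset.sum_const, nsmul_eq_mul]
      gcongr
      exact hfib c hc

section PadicTransfer

variable {p : ℕ} [Fact p.Prime] [MeasurableSpace ℤ_[p]] [BorelSpace ℤ_[p]]
  {μ : Measure ℤ_[p]} [μ.IsAddHaarMeasure] [IsProbabilityMeasure μ]

theorem QIApHolds.exists_frequently_le (hQIA : QIApHolds p μ) {ρ : ℕ → ℝ} (hρ0 : ∀ n, 0 ≤ ρ n)
    (hρ : ∀ n, ρ n ≠ 0 → p.Coprime n ∧ n * (4 * ρ n) ≤ 1)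
    (hdiv : ∑' n, ∫⁻ x, ballCount n (ρ n) x = ⊤) :
    ∃ c : ENNReal, c ≠ 0 ∧ ∃ᶠ N in atTop,
      c * ∑ m ∈ Finset.Icc 1 N, ∑ n ∈ Finset.Icc 1 N,
        ∫⁻ x, ballCount m (ρ m) x * ballCount n (ρ n) x ≤
      (∑ n ∈ Finset.Icc 1 N, ∫⁻ x, ballCount n (ρ n) x) ^ 2 := by
  classical
  have hp : p.Prime := Fact.out
  have hp0 : (0 : ℝ) < p := by exact_mod_cast hp.pos
  have hk : ∀ n, ∃ k : ℕ, ρ n ≠ 0 → ((p : ℝ) ^ (k + 1))⁻¹ < 4 * ρ n ∧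
      4 * ρ n ≤ ((p : ℝ) ^ k)⁻¹ ∧ 0 < n ∧ n < p ^ (k + 1) ∧ p.Coprime n := by
    intro n
    by_cases h : ρ n = 0
    · exact ⟨0, fun h' => absurd h h'⟩
    obtain ⟨hpn, hle⟩ := hρ n h
    have hn : 0 < n := by
      rcases n.eq_zero_or_pos with rfl | hn
      · exact absurd (Nat.coprime_zero_right p |>.1 hpn) hp.one_lt.ne'
      · exact hn
    have hn1 : (1 : ℝ) ≤ n := by exact_mod_cast hn
    have hpos : 0 < ρ n := lt_of_le_of_ne (hρ0 n) (Ne.symm h)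
    obtain ⟨k, hk1, hk2⟩ := exists_nat_pow_near_of_lt_one (x := 4 * ρ n) (y := (p : ℝ)⁻¹)
      (by positivity) (by nlinarith) (by positivity) (inv_lt_one_of_one_lt₀ (by exact_mod_cast hp.one_lt))
    rw [inv_pow] at hk1 hk2
    refine ⟨k, fun _ => ⟨hk1, hk2, hn, ?_, hpn⟩⟩
    have h1 : (n : ℝ) < (p : ℝ) ^ (k + 1) := by
      have h2 : (n : ℝ) * ((p : ℝ) ^ (k + 1))⁻¹ < 1 := by nlinarith
      rwa [← div_eq_mul_inv, div_lt_one (by positivity)] at h2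
    exact_mod_cast h1
  choose k hk using hk
  set ψ : ℕ → ℝ := fun n => if ρ n = 0 then 0 else ((p : ℝ) ^ k n)⁻¹ with hψ
  have hψn : ∀ n, ρ n ≠ 0 → ψ n = ((p : ℝ) ^ k n)⁻¹ := fun n h => if_neg h
  have hlow : ∀ n, ∫⁻ x, ballCount n (ρ n) x ≤ (p + 1) * μ (padicE p ψ n) := by
    intro n
    by_cases h : ρ n = 0
    · simp [ballCount_of_nonpos n h.le]
    · obtain ⟨-, h2, -, h4, h5⟩ := hk n h
      exact lintegral_ballCount_le_measure μ h5 h4 h2 (hψn n h).ge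
  have hup : ∀ n, μ (padicE p ψ n) ≤ (6 * p) * ∫⁻ x, ballCount n (ρ n) x := by
    intro n
    by_cases h : ρ n = 0
    · rw [measure_padicE_eq_zero μ (if_pos h)]
      exact zero_le
    · obtain ⟨h1, h2, h3, -, h5⟩ := hk n h
      refine (measure_padicE_le μ h5 h3 (hψn n h).le).trans ?_
      have hp1 : (1 : ℝ) ≤ (p : ℝ) ^ k n := one_le_pow₀ (by exact_mod_cast hp.one_lt.le)
      have h0 := inv_le_one_of_one_le₀ hp1
      rw [lintegral_ballCount n (by linarith)]
      have h6 : ((p : ENNReal) ^ k n)⁻¹ ≤ 2 * p * ENNReal.ofReal (2 * ρ n) := by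
        have h7 : ((p : ENNReal) ^ k n)⁻¹ = ENNReal.ofReal (((p : ℝ) ^ k n)⁻¹) := by
          rw [ENNReal.ofReal_inv_of_pos (by positivity), ENNReal.ofReal_pow hp0.le,
            ENNReal.ofReal_natCast]
        have h8 : (2 * p : ENNReal) = ENNReal.ofReal (2 * p) := by
          rw [ENNReal.ofReal_mul (by norm_num), ENNReal.ofReal_natCast]
          norm_num
        rw [h7, h8, ← ENNReal.ofReal_mul (by positivity)]
        refine ENNReal.ofReal_le_ofReal ?_
        calc ((p : ℝ) ^ k n)⁻¹ = p * ((p : ℝ) ^ (k n + 1))⁻¹ := by rw [pow_succ]; field_simp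
          _ ≤ p * (4 * ρ n) := by gcongr
          _ = _ := by ring
      calc _ ≤ 3 * n.totient * (2 * p * ENNReal.ofReal (2 * ρ n)) := mul_le_mul_right h6 _
        _ = _ := by ring
  have hint : ∀ m n : ℕ, ∫⁻ x, ballCount m (ρ m) x * ballCount n (ρ n) x ≤
      (p + 1) ^ 2 * μ (padicE p ψ m ∩ padicE p ψ n) := by
    intro m n
    by_cases hm : ρ m = 0
    · simp [ballCount_of_nonpos m hm.le]
    by_cases hn : ρ n = 0
    · simp [ballCount_of_nonpos n hn.le]
    obtain ⟨-, h2, -, h4, h5⟩ := hk m hm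
    obtain ⟨-, h2', -, h4', h5'⟩ := hk n hn
    rcases le_total (k m) (k n) with h | h
    · exact lintegral_ballCount_mul_le_measure_inter μ h5 h5' h h4 h4' h2 h2' (hψn m hm).ge
        (hψn n hn).ge
    · simp only [mul_comm (ballCount m _ _)]
      rw [Set.inter_comm]
      exact lintegral_ballCount_mul_le_measure_inter μ h5' h5 h h4' h4 h2' h2 (hψn n hn).ge
        (hψn m hm).ge
  have htop : ∑' n, μ (padicE p ψ n) = ⊤ := by
    have h1 := ENNReal.tsum_le_tsum hlow
    rw [hdiv, ENNReal.tsum_mul_left, top_le_iff] at h1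
    by_contra h
    exact ENNReal.mul_ne_top (by simp) h h1
  have hψ0 : ∀ n, 0 ≤ ψ n := by
    intro n
    simp only [hψ]
    split_ifs <;> positivity
  obtain ⟨ε, hε0, hε⟩ := exists_between (hQIA ψ hψ0 htop)
  have hfreq := frequently_lt_of_lt_limsup (by isBoundedDefault) hε
  obtain ⟨A, hA⟩ : ∃ A : ENNReal, A = (p + 1) ^ 2 := ⟨_, rfl⟩
  obtain ⟨B, hB⟩ : ∃ B : ENNReal, B = 6 * p := ⟨_, rfl⟩
  have hAt : A ≠ ⊤ := by rw [hA]; finiteness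
  have hA0 : A ≠ 0 := by simp [hA]
  have hBt : B ^ 2 ≠ ⊤ := by rw [hB]; finiteness
  have hB0 : B ^ 2 ≠ 0 := by simp [hB, hp.ne_zero]
  rw [← hA] at hint
  rw [← hB] at hup
  refine ⟨ε * A⁻¹ * (B ^ 2)⁻¹,
    mul_ne_zero (mul_ne_zero hε0.ne' (ENNReal.inv_ne_zero.2 hAt)) (ENNReal.inv_ne_zero.2 hBt),
    hfreq.mono fun N hN => ?_⟩
  have h1 := ENNReal.mul_le_of_le_div hN.le
  have h2 : ∑ m ∈ Finset.Icc 1 N, ∑ n ∈ Finset.Icc 1 N,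
      ∫⁻ x, ballCount m (ρ m) x * ballCount n (ρ n) x ≤ A * ∑ m ∈ Finset.Icc 1 N,
        ∑ n ∈ Finset.Icc 1 N, μ (padicE p ψ m ∩ padicE p ψ n) := by
    simp only [Finset.mul_sum]
    exact Finset.sum_le_sum fun m _ => Finset.sum_le_sum fun n _ => hint m n
  have h3 : ∑ n ∈ Finset.Icc 1 N, μ (padicE p ψ n) ≤
      B * ∑ n ∈ Finset.Icc 1 N, ∫⁻ x, ballCount n (ρ n) x := by
    simp only [Finset.mul_sum]
    exact Finset.sum_le_sum fun n _ => hup n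
  generalize ∑ m ∈ Finset.Icc 1 N, ∑ n ∈ Finset.Icc 1 N,
    μ (padicE p ψ m ∩ padicE p ψ n) = T at h1 h2
  generalize ∑ n ∈ Finset.Icc 1 N, ∫⁻ x, ballCount n (ρ n) x = S at h3 ⊢
  calc _ ≤ ε * A⁻¹ * (B ^ 2)⁻¹ * (A * T) := mul_le_mul_right h2 _
    _ = (A⁻¹ * A) * ((B ^ 2)⁻¹ * (ε * T)) := by ring
    _ = (B ^ 2)⁻¹ * (ε * T) := by rw [ENNReal.inv_mul_cancel hA0 hAt, one_mul]
    _ ≤ (B ^ 2)⁻¹ * (B * S) ^ 2 := by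
      gcongr
      exact h1.trans (by gcongr)
    _ = ((B ^ 2)⁻¹ * B ^ 2) * S ^ 2 := by ring
    _ = S ^ 2 := by rw [ENNReal.inv_mul_cancel hB0 hBt, one_mul]

theorem QIApHolds.volume_frequently_ballCount_pos_of_coprime (hQIA : QIApHolds p μ) {ρ : ℕ → ℝ}
    (hρ0 : ∀ n, 0 ≤ ρ n) (hρ1 : ∀ n, ρ n ≤ 1 / 2)
    (hρ : ∀ n, ρ n ≠ 0 → p.Coprime n ∧ n * (4 * ρ n) ≤ 1)
    (hdiv : ∑' n, ∫⁻ x, ballCount n (ρ n) x = ⊤) :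
    0 < volume {x | ∃ᶠ n in atTop, ballCount n (ρ n) x ≠ 0} := by
  obtain ⟨c, hc, hfreq⟩ := hQIA.exists_frequently_le hρ0 hρ hdiv
  refine measure_frequently_ne_zero_pos volume (fun n => ballCount n (ρ n))
    (fun n => measurable_ballCount n _) (ballCount_zero_left _) (fun n => ?_) hdiv hc hfreq
  rw [lintegral_ballCount n (hρ1 n)]
  finiteness

theorem QIApHolds.volume_frequently_ballCount_mul_pos (hQIA : QIApHolds p μ) {ρ : ℕ → ℝ}
    (hρ0 : ∀ n, 0 ≤ ρ n) (hρ : ∀ n, ρ n ≠ 0 → p.Coprime n ∧ n * (4 * (p * ρ n)) ≤ 1)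
    (hdiv : ∑' n, ∫⁻ x, ballCount (p * n) (ρ n) x = ⊤) :
    0 < volume {x | ∃ᶠ n in atTop, ballCount (p * n) (ρ n) x ≠ 0} := by
  have hp : p.Prime := Fact.out
  have hp0 : (0 : ℝ) < p := by exact_mod_cast hp.pos
  have hp1 : (1 : ℝ) ≤ p := by exact_mod_cast hp.one_lt.le
  have hρ1 : ∀ n, p * ρ n ≤ 1 / 2 := by
    intro n
    by_cases h : ρ n = 0
    · rw [h]
      norm_num
    obtain ⟨h1, h2⟩ := hρ n h
    have hn : n ≠ 0 := by
      rintro rfl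
      exact hp.one_lt.ne' ((Nat.coprime_zero_right p).1 h1)
    have hn1 : (1 : ℝ) ≤ n := by exact_mod_cast Nat.one_le_iff_ne_zero.2 hn
    have h3 : 0 ≤ p * ρ n := mul_nonneg hp0.le (hρ0 n)
    nlinarith
  have hρ2 : ∀ n, ρ n ≤ 1 / 2 := fun n =>
    (le_mul_of_one_le_left (hρ0 n) hp1).trans (hρ1 n)
  have hf : ∀ n, ∫⁻ x, ballCount n (p * ρ n) x = p * (n.totient * ENNReal.ofReal (2 * ρ n)) := by
    intro n
    rw [lintegral_ballCount n (hρ1 n), mul_left_comm, ENNReal.ofReal_mul hp0.le,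
      ENNReal.ofReal_natCast]
    ring
  have hg : ∀ n, ∫⁻ x, ballCount (p * n) (ρ n) x =
      (p - 1 : ℕ) * (n.totient * ENNReal.ofReal (2 * ρ n)) := by
    intro n
    rw [lintegral_ballCount _ (hρ2 n)]
    by_cases h : ρ n = 0
    · simp [h]
    rw [Nat.totient_mul (hρ n h).1, Nat.totient_prime hp]
    push_cast
    ring
  have hgf : ∀ n, ∫⁻ x, ballCount (p * n) (ρ n) x ≤ ∫⁻ x, ballCount n (p * ρ n) x := by
    intro n
    rw [hf, hg]
    gcongr
    exact Nat.sub_le p 1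
  have hfg : ∀ n, ∫⁻ x, ballCount n (p * ρ n) x ≤ 2 * ∫⁻ x, ballCount (p * n) (ρ n) x := by
    intro n
    have := hp.two_le
    have h1 : p ≤ 2 * (p - 1) := by omega
    rw [hf, hg]
    calc _ ≤ ((2 * (p - 1) : ℕ) : ENNReal) * (n.totient * ENNReal.ofReal (2 * ρ n)) := by gcongr
      _ = _ := by rw [Nat.cast_mul, mul_assoc, Nat.cast_ofNat]
  obtain ⟨c, hc, hfreq⟩ := hQIA.exists_frequently_le (ρ := fun n => p * ρ n)
    (fun n => mul_nonneg hp0.le (hρ0 n)) (fun n h => hρ n (right_ne_zero_of_mul h))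
    (by rw [← top_le_iff, ← hdiv]; exact ENNReal.tsum_le_tsum hgf)
  have hint : ∀ m n, ∫⁻ x, ballCount (p * m) (ρ m) x * ballCount (p * n) (ρ n) x ≤
      p ^ 2 * ∫⁻ x, ballCount m (p * ρ m) x * ballCount n (p * ρ n) x := by
    intro m n
    have hpres : MeasurePreserving (fun x : UnitAddCircle => p • x) := by
      simpa using Measure.measurePreserving_zsmul (volume : Measure UnitAddCircle)
        (n := (p : ℤ)) (by exact_mod_cast hp.ne_zero)
    have hcomp := hpres.lintegral_comp
      ((measurable_ballCount m (p * ρ m)).mul (measurable_ballCount n (p * ρ n)))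
    simp only [Pi.mul_apply] at hcomp
    rw [← hcomp, ← lintegral_const_mul']
    · refine lintegral_mono fun x => ?_
      calc _ ≤ (p * ballCount m (p * ρ m) (p • x)) * (p * ballCount n (p * ρ n) (p • x)) :=
            mul_le_mul' (ballCount_mul_le hp.pos m _ x) (ballCount_mul_le hp.pos n _ x)
        _ = _ := by ring
    · finiteness
  obtain ⟨A, hA⟩ : ∃ A : ENNReal, A = p ^ 2 := ⟨_, rfl⟩
  have hAt : A ≠ ⊤ := by rw [hA]; finiteness
  have hA0 : A ≠ 0 := by simp [hA, hp.ne_zero]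
  rw [← hA] at hint
  refine measure_frequently_ne_zero_pos volume (fun n => ballCount (p * n) (ρ n))
    (fun n => measurable_ballCount _ _) (by rw [mul_zero, ballCount_zero_left])
    (fun n => ?_) hdiv (c := c * A⁻¹ * (2 ^ 2)⁻¹)
    (mul_ne_zero (mul_ne_zero hc (ENNReal.inv_ne_zero.2 hAt)) (ENNReal.inv_ne_zero.2 (by finiteness)))
    (hfreq.mono fun N hN => ?_)
  · rw [hg]
    finiteness
  have h2 : ∑ m ∈ Finset.Icc 1 N, ∑ n ∈ Finset.Icc 1 N,
      ∫⁻ x, ballCount (p * m) (ρ m) x * ballCount (p * n) (ρ n) x ≤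
      A * ∑ m ∈ Finset.Icc 1 N, ∑ n ∈ Finset.Icc 1 N,
        ∫⁻ x, ballCount m (p * ρ m) x * ballCount n (p * ρ n) x := by
    simp only [Finset.mul_sum]
    exact Finset.sum_le_sum fun m _ => Finset.sum_le_sum fun n _ => hint m n
  have h3 : ∑ n ∈ Finset.Icc 1 N, ∫⁻ x, ballCount n (p * ρ n) x ≤
      2 * ∑ n ∈ Finset.Icc 1 N, ∫⁻ x, ballCount (p * n) (ρ n) x := by
    simp only [Finset.mul_sum]
    exact Finset.sum_le_sum fun n _ => hfg n
  generalize ∑ m ∈ Finset.Icc 1 N, ∑ n ∈ Finset.Icc 1 N,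
    ∫⁻ x, ballCount m (p * ρ m) x * ballCount n (p * ρ n) x = T at hN h2
  generalize ∑ n ∈ Finset.Icc 1 N, ∫⁻ x, ballCount n (p * ρ n) x = S' at h3 hN
  generalize ∑ n ∈ Finset.Icc 1 N, ∫⁻ x, ballCount (p * n) (ρ n) x = S at h3 ⊢
  calc _ ≤ c * A⁻¹ * (2 ^ 2)⁻¹ * (A * T) := mul_le_mul_right h2 _
    _ = (A⁻¹ * A) * ((2 ^ 2)⁻¹ * (c * T)) := by ring
    _ = (2 ^ 2)⁻¹ * (c * T) := by rw [ENNReal.inv_mul_cancel hA0 hAt, one_mul]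
    _ ≤ (2 ^ 2)⁻¹ * (2 * S) ^ 2 := by
      gcongr
      exact hN.trans (by gcongr)
    _ = ((2 ^ 2)⁻¹ * 2 ^ 2) * S ^ 2 := by ring
    _ = S ^ 2 := by rw [ENNReal.inv_mul_cancel (by simp) (by finiteness), one_mul]

end PadicTransfer

theorem mem_circleA_iff {ψ : ℕ → ℝ} {n : ℕ} {x : UnitAddCircle} :
    x ∈ circleA ψ n ↔ ∃ b ∈ orderPoints n, ‖x - b‖ ≤ ψ n := by
  constructor
  · rintro ⟨a, ha1, han, hgcd, hx⟩
    rcases han.lt_or_eq with h | rfl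
    · exact ⟨_, mem_orderPoints_iff_exists.2 ⟨a, h, hgcd, rfl⟩, hx⟩
    · rw [Nat.gcd_self] at hgcd
      subst hgcd
      refine ⟨_, mem_orderPoints_iff_exists.2 ⟨0, one_pos, by norm_num, ?_⟩, hx⟩
      simpa using (AddCircle.coe_period (1 : ℝ)).symm
  · rintro ⟨b, hb, hx⟩
    obtain ⟨a, han, hcop, rfl⟩ := mem_orderPoints_iff_exists.1 hb
    rcases Nat.eq_zero_or_pos a with rfl | ha
    · obtain rfl : n = 1 := (Nat.coprime_zero_left n).1 hcop
      exact ⟨1, le_rfl, le_rfl, by simp, by simpa [AddCircle.coe_period (1 : ℝ)] using hx⟩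
    · exact ⟨a, ha, han.le, hcop, hx⟩

theorem circleW_mono {ψ ψ' : ℕ → ℝ} (h : ∀ n, ψ n ≤ ψ' n) : circleW ψ ⊆ circleW ψ' := by
  refine fun x hx => Set.Infinite.mono ?_ hx
  rintro n ⟨a, h1, h2, h3, h4⟩
  exact ⟨a, h1, h2, h3, h4.trans (h n)⟩

theorem ballCount_ne_zero_mono {n : ℕ} {ρ σ : ℝ} (h : ρ ≤ σ) {x : UnitAddCircle}
    (hx : ballCount n ρ x ≠ 0) : ballCount n σ x ≠ 0 := by
  rw [ballCount_ne_zero_iff] at hx ⊢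
  obtain ⟨b, hb, hxb⟩ := hx
  exact ⟨b, hb, hxb.trans_le h⟩

theorem volume_circleA_le (ψ : ℕ → ℝ) {n : ℕ} (hψ : ψ n ≤ 1 / 2) :
    volume (circleA ψ n) ≤ ∫⁻ x, ballCount n (ψ n) x := by
  have hsub : circleA ψ n ⊆ ⋃ b ∈ orderPoints n, Metric.closedBall b (ψ n) := by
    intro x hx
    obtain ⟨b, hb, hxb⟩ := mem_circleA_iff.1 hx
    exact Set.mem_biUnion (Finset.mem_coe.2 hb) (mem_closedBall_iff_norm.2 hxb)
  calc volume (circleA ψ n) ≤ _ := measure_mono hsub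
    _ ≤ _ := measure_biUnion_finset_le _ _
    _ = _ := by
      simp only [AddCircle.volume_closedBall]
      rw [lintegral_ballCount n hψ, Finset.sum_const, card_orderPoints, nsmul_eq_mul,
        min_eq_right (by linarith)]

theorem le_volume_circleA (ψ : ℕ → ℝ) {n : ℕ} (hn : 0 < n) (hψ : ψ n ≤ 1 / 2) :
    ENNReal.ofReal (2 * ψ n) ≤ volume (circleA ψ n) := by
  have h1 := AddCircle.volume_closedBall (T := (1 : ℝ)) (x := (((1 : ℕ) : ℝ) / (n : ℝ) : ℝ)) (ψ n)
  rw [min_eq_right (by linarith)] at h1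
  rw [← h1]
  refine measure_mono fun x hx => ⟨1, le_rfl, hn, by simp, ?_⟩
  exact mem_closedBall_iff_norm.1 hx

/-- Gallagher's zero-one law for the sets `W_∞(ψ)`. -/
theorem volume_circleW_eq_one_of_pos {ψ : ℕ → ℝ} (hψ : Tendsto ψ atTop (nhds 0))
    (hpos : 0 < volume {x | ∃ᶠ n in atTop, ballCount n (ψ n) x ≠ 0}) :
    volume (circleW ψ) = 1 := by
  have hset : {x | ∃ᶠ n in atTop, ballCount n (ψ n) x ≠ 0} =
      addWellApproximable UnitAddCircle ψ := by
    ext x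
    rw [Set.mem_ofPred_eq, Nat.frequently_atTop_iff_infinite,
      UnitAddCircle.mem_addWellApproximable_iff]
    simp only [ballCount_ne_zero_iff, mem_orderPoints_iff_exists]
    have : ∀ n : ℕ, (∃ b, (∃ a < n, Nat.Coprime a n ∧ ((a / n : ℝ) : UnitAddCircle) = b) ∧
        ‖x - b‖ < ψ n) ↔ ∃ m < n, gcd m n = 1 ∧ ‖x - ((m / n : ℝ) : UnitAddCircle)‖ < ψ n := by
      intro n
      constructor
      · rintro ⟨_, ⟨a, ha, hc, rfl⟩, h⟩
        exact ⟨a, ha, hc, h⟩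
      · rintro ⟨a, ha, hc, h⟩
        exact ⟨_, ⟨a, ha, hc, rfl⟩, h⟩
    simp only [this]
  have hsub : {x | ∃ᶠ n in atTop, ballCount n (ψ n) x ≠ 0} ⊆ circleW ψ := by
    intro x hx
    refine Set.Infinite.mono ?_ (Nat.frequently_atTop_iff_infinite.1 hx)
    intro n hn
    obtain ⟨b, hb, hxb⟩ := ballCount_ne_zero_iff.1 hn
    exact mem_circleA_iff.2 ⟨b, hb, hxb.le⟩
  rcases AddCircle.addWellApproximable_ae_empty_or_univ (T := 1) ψ hψ with h | h
  · rw [hset] at hpos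
    exact absurd (measure_eq_zero_iff_ae_notMem.2 h) hpos.ne'
  · refine le_antisymm ((measure_mono (Set.subset_univ _)).trans_eq (by simp)) ?_
    rw [hset] at hsub
    have h1 : volume (addWellApproximable UnitAddCircle ψ) = 1 := by
      exact (measure_congr (eventuallyEq_univ.2 h)).trans (by simp)
    rw [← h1]
    exact measure_mono hsub

theorem QIApHolds.volume_circleW_eq_one_of_tendsto {p : ℕ} [Fact p.Prime] [MeasurableSpace ℤ_[p]]
    [BorelSpace ℤ_[p]] {μ : Measure ℤ_[p]} [μ.IsAddHaarMeasure] [IsProbabilityMeasure μ]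
    (hQIA : QIApHolds p μ) {ψ : ℕ → ℝ} (hψ0 : ∀ n, 0 ≤ ψ n) (hψ1 : ∀ n, ψ n ≤ 1 / 2)
    (hsupp : ∀ n, ¬ Squarefree n → ψ n = 0) (hlim : Tendsto ψ atTop (nhds 0))
    (hdiv : ∑' n, volume (circleA ψ n) = ⊤) : volume (circleW ψ) = 1 := by
  classical
  have hp : p.Prime := Fact.out
  refine volume_circleW_eq_one_of_pos hlim ?_
  have hdiv' : ∑' n, ∫⁻ x, ballCount n (ψ n) x = ⊤ := by
    rw [← top_le_iff, ← hdiv]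
    exact ENNReal.tsum_le_tsum fun n => volume_circleA_le ψ (hψ1 n)
  have hmono : ∀ ρ : ℕ → ℝ, (∀ n, ρ n ≤ ψ n) →
      0 < volume {x | ∃ᶠ n in atTop, ballCount n (ρ n) x ≠ 0} →
      0 < volume {x | ∃ᶠ n in atTop, ballCount n (ψ n) x ≠ 0} := fun ρ hρ h =>
    h.trans_le (measure_mono fun x hx => hx.mono fun n => ballCount_ne_zero_mono (hρ n))
  set ψ₁ : ℕ → ℝ := fun n => if 1 / 4 ≤ n * ψ n then ψ n else 0 with hψ₁
  set ψ₂ : ℕ → ℝ := fun n => if n * ψ n < 1 / 4 ∧ ¬ p ∣ n then ψ n else 0 with hψ₂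
  set ψ₃ : ℕ → ℝ := fun n => if n * ψ n < 1 / 4 ∧ p ∣ n then ψ n else 0 with hψ₃
  have hle : ∀ (P : Prop) [Decidable P] (n : ℕ), (if P then ψ n else 0) ≤ ψ n := by
    intro P _ n
    split_ifs
    exacts [le_rfl, hψ0 n]
  have hne : ∀ (P : Prop) [Decidable P] (n : ℕ), (if P then ψ n else 0) ≠ 0 → P ∧ ψ n ≠ 0 := by
    intro P _ n h
    split_ifs at h with hP
    exacts [⟨hP, h⟩, absurd rfl h]
  have hsplit : ∀ n, ∫⁻ x, ballCount n (ψ n) x = (∫⁻ x, ballCount n (ψ₁ n) x) +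
      ((∫⁻ x, ballCount n (ψ₂ n) x) + ∫⁻ x, ballCount n (ψ₃ n) x) := by
    intro n
    have h0 := ballCount_of_nonpos n (le_refl (0 : ℝ))
    simp only [hψ₁, hψ₂, hψ₃]
    by_cases h1 : 1 / 4 ≤ n * ψ n
    · simp only [h1, not_lt.2 h1, if_true, false_and, if_false, h0, Pi.zero_apply, lintegral_zero,
        add_zero]
    · by_cases h2 : p ∣ n
      · simp only [h1, not_le.1 h1, h2, not_true, and_true, and_false, if_true, if_false, h0,
          Pi.zero_apply, lintegral_zero, zero_add]
      · simp only [h1, not_le.1 h1, h2, not_false_eq_true, and_true, and_false, if_true, if_false,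
          h0, Pi.zero_apply, lintegral_zero, zero_add, add_zero]
  simp only [hsplit] at hdiv'
  rw [ENNReal.tsum_add, ENNReal.tsum_add, ENNReal.add_eq_top, ENNReal.add_eq_top] at hdiv'
  rcases hdiv' with h | h | h
  · refine hmono ψ₁ (fun n => hle _ n) (volume_frequently_ballCount_pos_of_overlap
      (fun n => (hle _ n).trans (hψ1 n)) (fun n hn => ?_) h)
    obtain ⟨h1, h2⟩ := hne _ n hn
    refine ⟨not_not.1 (mt (hsupp n) h2), ?_⟩
    simp only [hψ₁]
    rwa [if_pos h1]
  · refine hmono ψ₂ (fun n => hle _ n) (hQIA.volume_frequently_ballCount_pos_of_coprime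
      (fun n => ?_) (fun n => (hle _ n).trans (hψ1 n)) (fun n hn => ?_) h)
    · simp only [hψ₂]
      split_ifs
      exacts [hψ0 n, le_rfl]
    · obtain ⟨⟨h1, h2⟩, h3⟩ := hne _ n hn
      refine ⟨(hp.coprime_iff_not_dvd).2 h2, ?_⟩
      have := mul_le_mul_of_nonneg_left (hle (n * ψ n < 1 / 4 ∧ ¬ p ∣ n) n) n.cast_nonneg
      simp only [hψ₂]
      linarith
  · have hinj : Function.Injective (p * · : ℕ → ℕ) := fun a b h =>
      Nat.eq_of_mul_eq_mul_left hp.pos h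
    have h3 : ∑' m, ∫⁻ x, ballCount (p * m) (ψ₃ (p * m)) x = ⊤ := by
      rw [← h]
      refine hinj.tsum_eq (f := fun n => ∫⁻ x, ballCount n (ψ₃ n) x) ?_
      intro n hn
      by_contra hnr
      refine hn ?_
      have h4 : ψ₃ n = 0 := if_neg fun h5 => hnr (by
        obtain ⟨m, hm⟩ := h5.2
        exact ⟨m, hm.symm⟩)
      simp [h4, ballCount_of_nonpos n le_rfl]
    refine hmono ψ₃ (fun n => hle _ n) ((hQIA.volume_frequently_ballCount_mul_pos
      (fun n => ?_) (fun n hn => ?_) h3).trans_le (measure_mono fun x hx => ?_))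
    · simp only [hψ₃]
      split_ifs
      exacts [hψ0 _, le_rfl]
    · obtain ⟨⟨h1, h2⟩, h4⟩ := hne _ (p * n) hn
      refine ⟨Nat.coprime_of_squarefree_mul (not_not.1 (mt (hsupp _) h4)), ?_⟩
      have := mul_le_mul_of_nonneg_left
        (hle (((p * n : ℕ) : ℝ) * ψ (p * n) < 1 / 4 ∧ p ∣ p * n) (p * n)) (p * n).cast_nonneg
        (α := ℝ)
      simp only [hψ₃]
      push_cast at this h1 ⊢
      linarith
    · exact (tendsto_id.const_mul_atTop' hp.pos).frequently hx

theorem exists_tendsto_zero_le_of_not_tendsto {ψ : ℕ → ℝ} (hψ0 : ∀ n, 0 ≤ ψ n)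
    (hψ1 : ∀ n, ψ n ≤ 1 / 2) (hz : ψ 0 = 0) (hlim : ¬ Tendsto ψ atTop (nhds 0)) :
    ∃ ψ' : ℕ → ℝ, (∀ n, 0 ≤ ψ' n) ∧ (∀ n, ψ' n ≤ ψ n) ∧ Tendsto ψ' atTop (nhds 0) ∧
      ∑' n, volume (circleA ψ' n) = ⊤ := by
  classical
  obtain ⟨ε, hε, hfreq⟩ : ∃ ε > 0, ∃ᶠ n in atTop, ε ≤ ψ n := by
    rw [Metric.tendsto_nhds] at hlim
    push Not at hlim
    obtain ⟨ε, hε, h⟩ := hlim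
    refine ⟨ε, hε, h.mono fun n hn => ?_⟩
    rwa [Real.dist_eq, sub_zero, abs_of_nonneg (hψ0 n)] at hn
  have hinf : {n | ε ≤ ψ n}.Infinite := Nat.frequently_atTop_iff_infinite.1 hfreq
  have hcount : ∀ k, Nat.count (fun n => ε ≤ ψ n) (Nat.nth (fun n => ε ≤ ψ n) k) = k := fun k =>
    Nat.count_nth_of_infinite hinf k
  set w : ℕ → ℝ := fun n => ε / (Nat.count (fun n => ε ≤ ψ n) n + 1) with hw
  have hw0 : ∀ n, 0 ≤ w n := fun n => by positivity
  have hwε : ∀ n, w n ≤ ε := fun n => div_le_self hε.le (by simp)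
  have hwlim : Tendsto w atTop (nhds 0) := by
    have h1 : Tendsto (fun n => (Nat.count (fun n => ε ≤ ψ n) n : ℝ)) atTop atTop :=
      tendsto_natCast_atTop_atTop.comp (tendsto_atTop_atTop_of_monotone (Nat.count_monotone _)
        fun k => ⟨_, (hcount k).ge⟩)
    exact (tendsto_atTop_add_const_right _ 1 h1).const_div_atTop ε
  set ψ' : ℕ → ℝ := fun n => if ε ≤ ψ n then w n else 0 with hψ'
  have h0 : ∀ n, 0 ≤ ψ' n := by
    intro n
    simp only [hψ']
    split_ifs
    exacts [hw0 n, le_rfl]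
  have hle : ∀ n, ψ' n ≤ ψ n := by
    intro n
    simp only [hψ']
    split_ifs with h
    exacts [(hwε n).trans h, hψ0 n]
  refine ⟨ψ', h0, hle, squeeze_zero h0 (fun n => ?_) hwlim, ?_⟩
  · simp only [hψ']
    split_ifs
    exacts [le_rfl, hw0 n]
  · by_contra hne
    have hinj : Function.Injective (Nat.nth fun n => ε ≤ ψ n) := Nat.nth_injective hinf
    have hval : ∀ k, ψ' (Nat.nth (fun n => ε ≤ ψ n) k) = ε / (k + 1) := by
      intro k
      simp only [hψ', hw]
      rw [if_pos (Nat.nth_mem_of_infinite hinf k), hcount]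
    have hle' : ∑' k : ℕ, ENNReal.ofReal (ε / (k + 1)) ≤ ∑' n, volume (circleA ψ' n) := by
      refine le_trans (ENNReal.tsum_le_tsum fun k => ?_)
        (ENNReal.tsum_comp_le_tsum_of_injective hinj _)
      have hpos : 0 < Nat.nth (fun n => ε ≤ ψ n) k := by
        rw [Nat.pos_iff_ne_zero]
        intro h
        have := Nat.nth_mem_of_infinite hinf k
        rw [h, hz] at this
        linarith
      refine le_trans (ENNReal.ofReal_le_ofReal ?_)
        (le_volume_circleA ψ' hpos ((hle _).trans (hψ1 _)))
      rw [hval]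
      have : 0 ≤ ε / ((k : ℝ) + 1) := by positivity
      linarith
    have hsum := ENNReal.summable_toReal (ne_top_of_le_ne_top hne hle')
    have h1 : Summable fun k : ℕ => ε * (1 / ((k + 1 : ℕ) : ℝ)) := by
      refine hsum.congr fun k => ?_
      rw [ENNReal.toReal_ofReal (by positivity)]
      push_cast
      ring
    rw [summable_mul_left_iff hε.ne', summable_nat_add_iff (f := fun k : ℕ => 1 / (k : ℝ)) 1] at h1
    exact Real.not_summable_one_div_natCast h1

/-- **Corollary 1 (Haynes).** If `(QIA_p)` holds for some prime `p`, then the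
Duffin-Schaeffer Conjecture holds for every non-negative `ψ` supported on the set of
squarefree integers: the divergence of `Σ λ(A_n(ψ))` implies `λ(W_∞(ψ)) = 1`. -/
theorem stmt1 (p : ℕ) [Fact p.Prime] [MeasurableSpace ℤ_[p]] [BorelSpace ℤ_[p]]
    (μ : Measure ℤ_[p]) [μ.IsAddHaarMeasure] [IsProbabilityMeasure μ]
    (hQIA : QIApHolds p μ)
    (ψ : ℕ → ℝ) (hψ : ∀ n, 0 ≤ ψ n) (hsupp : ∀ n : ℕ, ¬ Squarefree n → ψ n = 0)
    (hdiv : ∑' n : ℕ, volume (circleA ψ n) = ⊤) :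
    volume (circleW ψ) = 1 := by
  set ψ₀ : ℕ → ℝ := fun n => min (ψ n) (1 / 2) with hψ₀
  have hA : ∀ n, circleA ψ₀ n = circleA ψ n := by
    intro n
    ext x
    have hhalf : ∀ y : UnitAddCircle, ‖y‖ ≤ 1 / 2 := fun y => by
      simpa using AddCircle.norm_le_half_period (1 : ℝ) one_ne_zero (x := y)
    simp only [circleA, hψ₀, le_min_iff, hhalf, and_true]
  have hW : circleW ψ₀ = circleW ψ := by simp only [circleW, hA]
  have h0 : ∀ n, 0 ≤ ψ₀ n := fun n => le_min (hψ n) (by norm_num)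
  have h1 : ∀ n, ψ₀ n ≤ 1 / 2 := fun n => min_le_right _ _
  have hs : ∀ n, ¬ Squarefree n → ψ₀ n = 0 := fun n hn => by
    simp only [hψ₀]
    rw [hsupp n hn]
    norm_num
  by_cases hlim : Tendsto ψ₀ atTop (nhds 0)
  · rw [← hW]
    exact hQIA.volume_circleW_eq_one_of_tendsto h0 h1 hs hlim (by simpa only [hA] using hdiv)
  · obtain ⟨ψ', h0', hle, hlim', hdiv'⟩ :=
      exists_tendsto_zero_le_of_not_tendsto h0 h1 (hs 0 not_squarefree_zero) hlim
    have h2 := hQIA.volume_circleW_eq_one_of_tendsto h0' (fun n => (hle n).trans (h1 n))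
      (fun n hn => le_antisymm ((hle n).trans (hs n hn).le) (h0' n)) hlim' hdiv'
    refine le_antisymm ((measure_mono (Set.subset_univ _)).trans_eq (by simp)) ?_
    rw [← h2, ← hW]
    exact measure_mono (circleW_mono hle)
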